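/- arXiv:1504.00194 — 4 statements merged into one kernel-verified Lean document; each statement's English description precedes it below -/
import Mathlib

section
/- Let D be a division ring, σ a ring automorphism of D, and d ∈ D. The twisted polynomial f(t) = t³ − d is irreducible in D[t;σ] if and only if d ≠ σ²(z)·σ(z)·z for all z ∈ D. -/
/-!
Twisted polynomial ring `D[t;σ]` over a division ring `D`, modeled on finitely
supported functions `ℕ →₀ D` recording left coefficients: `f = ∑ f i * t ^ i`,
with multiplication determined by `(a t^i) (b t^j) = a σ^i(b) t^{i+j}`.
-/

/-- Multiplication in the twisted polynomial ring `D[t;σ]`. -/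
noncomputable def tMul {D : Type*} [DivisionRing D] (σ : D ≃+* D) (f g : ℕ →₀ D) : ℕ →₀ D :=
  f.sum fun i a => g.sum fun j b => Finsupp.single (i + j) (a * (σ ^ i) b)

/-- The degree of a twisted polynomial (`⊥` for the zero polynomial). -/
noncomputable def tDeg {D : Type*} [DivisionRing D] (f : ℕ →₀ D) : WithBot ℕ := f.support.max

/-- A twisted polynomial of positive degree is irreducible iff it admits no factorization
`f = g * h` with `deg g < deg f` and `deg h < deg f`. -/
def tIrred {D : Type*} [DivisionRing D] (σ : D ≃+* D) (f : ℕ →₀ D) : Prop :=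
  ¬ ∃ g h : ℕ →₀ D, tDeg g < tDeg f ∧ tDeg h < tDeg f ∧ f = tMul σ g h

theorem tDeg_lt_natCast_iff {D : Type*} [DivisionRing D] {f : ℕ →₀ D} {n : ℕ} :
    tDeg f < (n : WithBot ℕ) ↔ ∀ i, n ≤ i → f i = 0 := by
  rw [tDeg, Finset.max_eq_sup_withBot]
  refine (Finset.sup_lt_iff (WithBot.bot_lt_coe n)).trans (forall_congr' fun i => ?_)
  rw [Finsupp.mem_support_iff, ← not_imp_not, not_not]
  exact imp_congr_left (by simp)

theorem tDeg_cubic {D : Type*} [DivisionRing D] (d : D) :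
    tDeg (Finsupp.single 3 (1 : D) - Finsupp.single 0 d) = ((3 : ℕ) : WithBot ℕ) := by
  apply le_antisymm
  · refine Finset.max_le fun i hi => WithBot.coe_le_coe.2 ?_
    by_contra! h
    simp [show 3 ≠ i by lia, show i ≠ 0 by lia] at hi
  · exact Finset.le_max (by simp)

theorem tMul_apply_of_tDeg_lt {D : Type*} [DivisionRing D] (σ : D ≃+* D) {f g : ℕ →₀ D} {m n : ℕ}
    (hf : tDeg f < (m : WithBot ℕ)) (hg : tDeg g < (n : WithBot ℕ)) (k : ℕ) :
    tMul σ f g k = ∑ i ∈ Finset.range m, ∑ j ∈ Finset.range n,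
      if i + j = k then f i * (σ ^ i) (g j) else 0 := by
  have support_subset {p : ℕ →₀ D} {r : ℕ} (hp : tDeg p < (r : WithBot ℕ)) :
      p.support ⊆ Finset.range r := fun i hi => by
    by_contra h
    exact Finsupp.mem_support_iff.1 hi
      (tDeg_lt_natCast_iff.1 hp i (by simpa using h))
  rw [tMul, Finsupp.sum_of_support_subset f (support_subset hf) _ (by simp),
    Finsupp.finsetSum_apply]
  refine Finset.sum_congr rfl fun i _ => ?_
  rw [Finsupp.sum_of_support_subset g (support_subset hg) _ (by simp),
    Finsupp.finsetSum_apply]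
  exact Finset.sum_congr rfl fun j _ => Finsupp.single_apply

/-- The factorization `t³ - d = (t² + σ²(z) t + σ²(z) σ(z)) (t - z)` for `d = σ²(z) σ(z) z`. -/
theorem exists_factorization {D : Type*} [DivisionRing D] (σ : D ≃+* D) (z : D) :
    ∃ g h : ℕ →₀ D, tDeg g < ((3 : ℕ) : WithBot ℕ) ∧ tDeg h < ((3 : ℕ) : WithBot ℕ) ∧
      Finsupp.single 3 (1 : D) - Finsupp.single 0 ((σ ^ 2) z * σ z * z) = tMul σ g h := by
  set g : ℕ →₀ D := Finsupp.single 2 1 + Finsupp.single 1 ((σ ^ 2) z) +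
    Finsupp.single 0 ((σ ^ 2) z * σ z)
  set h : ℕ →₀ D := Finsupp.single 1 1 - Finsupp.single 0 z
  have hg : tDeg g < ((3 : ℕ) : WithBot ℕ) := tDeg_lt_natCast_iff.2 fun i hi => by
    simp [g, show 2 ≠ i by lia, show 1 ≠ i by lia, show 0 ≠ i by lia]
  have hh : tDeg h < ((3 : ℕ) : WithBot ℕ) := tDeg_lt_natCast_iff.2 fun i hi => by
    simp [h, show 1 ≠ i by lia, show 0 ≠ i by lia]
  refine ⟨g, h, hg, hh, Finsupp.ext fun k => ?_⟩
  rw [tMul_apply_of_tDeg_lt σ hg hh]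
  rcases k with _ | _ | _ | _ | k <;>
    simp [Finset.sum_range_succ, g, h, Finsupp.single_apply, mul_assoc]

/-- If `t³ - d` is a product of two twisted polynomials of degree less than `3`, then
`d = σ²(z) σ(z) z` for some `z`. -/
theorem exists_eq_of_factorization {D : Type*} [DivisionRing D] (σ : D ≃+* D) {d : D}
    {g h : ℕ →₀ D} (hg : tDeg g < ((3 : ℕ) : WithBot ℕ)) (hh : tDeg h < ((3 : ℕ) : WithBot ℕ))
    (H : Finsupp.single 3 (1 : D) - Finsupp.single 0 d = tMul σ g h) :
    ∃ z : D, d = (σ ^ 2) z * σ z * z := by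
  have coeff_eq (k : ℕ) := (DFunLike.congr_fun H k).trans (tMul_apply_of_tDeg_lt σ hg hh k)
  have h0 : -d = g 0 * h 0 := by
    simpa [Finset.sum_range_succ, Finsupp.single_apply] using coeff_eq 0
  have h1 : 0 = g 0 * h 1 + g 1 * σ (h 0) := by
    simpa [Finset.sum_range_succ, Finsupp.single_apply] using coeff_eq 1
  have h2 : 0 = g 0 * h 2 + g 1 * σ (h 1) + g 2 * (σ ^ 2) (h 0) := by
    simpa [Finset.sum_range_succ, Finsupp.single_apply] using coeff_eq 2
  have h3 : 1 = g 1 * σ (h 2) + g 2 * (σ ^ 2) (h 1) := by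
    simpa [Finset.sum_range_succ, Finsupp.single_apply] using coeff_eq 3
  have h4 : g 2 = 0 ∨ h 2 = 0 := by
    simpa [Finset.sum_range_succ, Finsupp.single_apply] using coeff_eq 4
  rcases h4 with hg2 | hh2
  · simp only [hg2, zero_mul, add_zero] at h2 h3
    have hne : h 2 ≠ 0 := fun e => by simp [e] at h3
    obtain ⟨p, hp⟩ : ∃ p, h 1 = h 2 * p := ⟨(h 2)⁻¹ * h 1, by simp [hne]⟩
    obtain ⟨q, hq⟩ : ∃ q, h 0 = h 2 * q := ⟨(h 2)⁻¹ * h 0, by simp [hne]⟩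
    rw [hp, map_mul, ← mul_assoc, ← h3, one_mul] at h2
    have hw : g 0 * h 2 = -σ p := eq_neg_of_add_eq_zero_left h2.symm
    rw [hp, hq, map_mul, ← mul_assoc, ← mul_assoc, ← h3, hw, one_mul] at h1
    have hσq : σ q = σ p * p := by
      rw [neg_mul] at h1
      exact (neg_add_eq_zero.1 h1.symm).symm
    refine ⟨σ.symm p, ?_⟩
    have hq' : q = p * σ.symm p := σ.injective (by simp [hσq])
    rw [hq, ← mul_assoc, hw, neg_mul, neg_inj, hq', ← mul_assoc] at h0
    simpa [pow_two] using h0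
  · simp only [hh2, map_zero, mul_zero, zero_add] at h2 h3
    have hne : h 1 ≠ 0 := fun e => by simp [e] at h3
    obtain ⟨z, hz⟩ : ∃ z, h 0 = -(h 1 * z) := ⟨-((h 1)⁻¹ * h 0), by simp [hne]⟩
    refine ⟨z, ?_⟩
    rw [hz, map_neg, map_mul, mul_neg, ← mul_assoc, ← h3, one_mul] at h2
    have hg1 : g 1 * σ (h 1) = (σ ^ 2) z := add_neg_eq_zero.1 h2.symm
    rw [hz, map_neg, map_mul, mul_neg, ← mul_assoc, hg1] at h1
    have hg0 : g 0 * h 1 = (σ ^ 2) z * σ z := add_neg_eq_zero.1 h1.symm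
    rwa [hz, mul_neg, neg_inj, ← mul_assoc, hg0] at h0

/-- Let `D` be a division ring, `σ` a ring automorphism of `D`, `d ∈ D`.
The twisted polynomial `f(t) = t³ − d` is irreducible in `D[t;σ]` iff
`d ≠ σ²(z)·σ(z)·z` for all `z ∈ D`. -/
theorem cubic_irreducible_iff {D : Type*} [DivisionRing D] (σ : D ≃+* D) (d : D) :
    tIrred σ (Finsupp.single 3 (1 : D) - Finsupp.single 0 d) ↔
      ∀ z : D, d ≠ (σ ^ 2) z * σ z * z := by
  rw [tIrred, tDeg_cubic]
  constructor
  · rintro H z rfl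
    exact H (exists_factorization σ z)
  · rintro H ⟨g, h, hg, hh, e⟩
    obtain ⟨z, hz⟩ := exists_eq_of_factorization σ hg hh e
    exact H z hz
end

section
/- Let D be a division ring, σ a ring automorphism of D, and d ∈ D. Suppose m is a prime number and the intersection of the center of D with the fixed ring of σ contains a primitive m-th root of unity. Then f(t) = t^m − d is irreducible in D[t;σ] if and only if d ≠ σ^{m−1}(z)·σ^{m−2}(z)⋯σ(z)·z for all z ∈ D. -/
section TwistedNorm

variable {D : Type*} [DivisionRing D] (σ : D ≃+* D)

/-- The twisted norm `σ^{k-1}(z) ⋯ σ(z) z`. -/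
def twistedNorm (z : D) (k : ℕ) : D := ((List.range k).reverse.map fun i => (σ ^ i) z).prod

theorem twistedNorm_zero (z : D) : twistedNorm σ z 0 = 1 := by simp [twistedNorm]

theorem twistedNorm_succ (z : D) (k : ℕ) :
    twistedNorm σ z (k + 1) = (σ ^ k) z * twistedNorm σ z k := by
  simp [twistedNorm, List.range_succ]

theorem twistedNorm_succ' (z : D) (k : ℕ) :
    twistedNorm σ z (k + 1) = σ (twistedNorm σ z k) * z := by
  induction k with
  | zero => simp [twistedNorm]
  | succ k ih =>
    rw [twistedNorm_succ, ih, ← mul_assoc, pow_succ', RingAut.mul_apply, ← map_mul,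
      ← twistedNorm_succ, ih]

end TwistedNorm

section TwistedPolynomial

variable {D : Type*} [DivisionRing D] (σ : D ≃+* D)

theorem tMul_add_left (f g h : ℕ →₀ D) : tMul σ (f + g) h = tMul σ f h + tMul σ g h := by
  unfold tMul
  refine Finsupp.sum_add_index' (fun i => by simp) fun i a b => ?_
  simp only [add_mul, Finsupp.single_add, Finsupp.sum_add]

theorem tMul_smul_left (c : D) (g h : ℕ →₀ D) : tMul σ (c • g) h = c • tMul σ g h := by
  unfold tMul
  rw [Finsupp.sum_smul_index' (fun i => by simp), Finsupp.smul_sum]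
  simp only [Finsupp.smul_sum, Finsupp.smul_single, smul_eq_mul, mul_assoc]

theorem tMul_single_sub (k : ℕ) (z : D) :
    tMul σ (Finsupp.single k 1) (Finsupp.single 1 1 - Finsupp.single 0 z) =
      Finsupp.single (k + 1) 1 - Finsupp.single k ((σ ^ k) z) := by
  unfold tMul
  rw [Finsupp.sum_single_index (by simp), Finsupp.sum_sub_index (by simp)]
  simp

theorem tDeg_single_sub {m : ℕ} (hm : m ≠ 0) (d : D) :
    tDeg (Finsupp.single m (1 : D) - Finsupp.single 0 d) = m := by
  classical
  refine le_antisymm (Finset.max_le fun i hi => ?_) (Finset.le_max ?_)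
  · have := Finsupp.support_sub hi
    simp only [Finset.mem_union, Finsupp.mem_support_iff, Finsupp.single_apply] at this
    rw [Nat.cast_withBot, WithBot.coe_le_coe]
    by_contra! h
    rw [if_neg (by omega), if_neg (by omega)] at this
    simp at this
  · simp [hm.symm]

theorem exists_tMul_eq_single_sub_twistedNorm (z : D) (k : ℕ) :
    ∃ q : ℕ →₀ D, tDeg q < k ∧ tMul σ q (Finsupp.single 1 1 - Finsupp.single 0 z) =
      Finsupp.single k 1 - Finsupp.single 0 (twistedNorm σ z k) := by
  induction k with
  | zero => exact ⟨0, by simp [tDeg], by simp [twistedNorm_zero, tMul]⟩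
  | succ k ih =>
    obtain ⟨q, hq, hmul⟩ := ih
    refine ⟨Finsupp.single k 1 + (σ ^ k) z • q, ?_, ?_⟩
    · rw [tDeg, Finset.max_eq_sup_withBot, Finset.sup_lt_iff (WithBot.bot_lt_coe _)]
      intro i hi
      rw [Nat.cast_withBot, WithBot.coe_lt_coe]
      by_contra! h
      have hqi : q i = 0 := by
        by_contra hne
        have h1 := (Finset.le_max (Finsupp.mem_support_iff.2 hne)).trans_lt hq
        rw [Nat.cast_withBot, WithBot.coe_lt_coe] at h1
        omega
      have hki : k ≠ i := by omega
      simp [hqi, hki] at hi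
    · rw [tMul_add_left, tMul_smul_left, hmul, tMul_single_sub, twistedNorm_succ]
      simp [smul_sub]

end TwistedPolynomial

section SemilinearEnd

variable {D V : Type*} [DivisionRing D] [AddCommGroup V] [Module D V] {σ : D ≃+* D}
  {T : AddMonoid.End V}

theorem pow_apply_smul_of_semilinear (hT : ∀ (a : D) v, T (a • v) = σ a • T v) (i : ℕ) (a : D)
    (v : V) : (T ^ i) (a • v) = (σ ^ i) a • (T ^ i) v := by
  induction i with
  | zero => simp
  | succ i ih =>
    simp only [pow_succ', AddMonoid.End.coe_mul, Function.comp_apply, RingAut.mul_apply, ih, hT]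

theorem linearCombination_tMul (hT : ∀ (a : D) v, T (a • v) = σ a • T v) (g h : ℕ →₀ D)
    (v : V) :
    Finsupp.linearCombination D (fun i => (T ^ i) v) (tMul σ g h) =
      Finsupp.linearCombination D
        (fun i => (T ^ i) (Finsupp.linearCombination D (fun j => (T ^ j) v) h)) g := by
  simp only [tMul, map_finsuppSum, Finsupp.linearCombination_single]
  rw [Finsupp.linearCombination_apply]
  refine Finsupp.sum_congr fun i _ => ?_
  rw [Finsupp.linearCombination_apply, map_finsuppSum, Finsupp.smul_sum]
  refine Finsupp.sum_congr fun j _ => ?_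
  rw [pow_apply_smul_of_semilinear hT, smul_smul, pow_add, AddMonoid.End.coe_mul,
    Function.comp_apply]

theorem exists_invariant_of_linearCombination_eq_zero
    (hT : ∀ (a : D) v, T (a • v) = σ a • T v) {g : ℕ →₀ D} (hg : g ≠ 0) {m : ℕ}
    (hgm : tDeg g < m) {v : V} (hv : v ≠ 0)
    (h0 : Finsupp.linearCombination D (fun i => (T ^ i) v) g = 0) :
    ∃ W : Submodule D V, (∀ w ∈ W, T w ∈ W) ∧ W ≠ ⊥ ∧ Module.finrank D W < m := by
  obtain ⟨N, hN⟩ := Finset.max_of_nonempty (Finsupp.support_nonempty_iff.2 hg)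
  have hNm : N < m := by
    rw [tDeg, hN, Nat.cast_withBot, WithBot.coe_lt_coe] at hgm
    exact hgm
  have hgN : g N ≠ 0 := Finsupp.mem_support_iff.1 (Finset.mem_of_max hN)
  have hle : ∀ i ∈ g.support, i ≤ N := fun i hi => Finset.le_max_of_eq hi hN
  let W := Submodule.span D (Set.range fun i : Fin N => (T ^ (i : ℕ)) v)
  have hmem : ∀ i < N, (T ^ i) v ∈ W := fun i hi => Submodule.subset_span ⟨⟨i, hi⟩, rfl⟩
  have hsum : ∑ i ∈ Finset.range N, g i • (T ^ i) v + g N • (T ^ N) v = 0 := by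
    rw [← Finset.sum_range_succ, ← h0, Finsupp.linearCombination_apply, Finsupp.sum]
    symm
    refine Finset.sum_subset (fun i hi => ?_) fun i _ hi => ?_
    · exact Finset.mem_range_succ_iff.2 (hle i hi)
    · rw [Finsupp.notMem_support_iff.1 hi, zero_smul]
  have hTN : (T ^ N) v ∈ W := by
    rw [← Submodule.smul_mem_iff _ hgN, eq_neg_of_add_eq_zero_right hsum]
    exact W.neg_mem (W.sum_mem fun i hi => W.smul_mem _ (hmem i (Finset.mem_range.1 hi)))
  refine ⟨W, fun w hw => ?_, fun hbot => ?_, ?_⟩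
  · induction hw using Submodule.span_induction with
    | mem x hx =>
      obtain ⟨i, rfl⟩ := hx
      have : T ((T ^ (i : ℕ)) v) = (T ^ (i + 1 : ℕ)) v := by
        rw [pow_succ', AddMonoid.End.coe_mul, Function.comp_apply]
      simp only [this]
      rcases (Nat.succ_le_of_lt i.2).lt_or_eq with h | h
      · exact hmem _ h
      · rw [show (i : ℕ) + 1 = N from h]
        exact hTN
    | zero => simp
    | add x y _ _ hx hy => rw [map_add]; exact W.add_mem hx hy
    | smul a x _ hx => rw [hT]; exact W.smul_mem _ hx
  · have h0W : v ∈ W := by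
      rcases Nat.eq_zero_or_pos N with h | h
      · subst h
        simpa using hTN
      · simpa using hmem 0 h
    rw [hbot, Submodule.mem_bot] at h0W
    exact hv h0W
  · exact ((finrank_range_le_card _).trans_eq (Fintype.card_fin N)).trans_lt hNm

/-- If `W` has least dimension among the nonzero invariant subspaces, then some invariant subspace
of dimension divisible by that of `W` contains every invariant subspace of the same dimension. -/
theorem exists_invariant_dvd_finrank [FiniteDimensional D V] {W : Submodule D V}
    (hmin : ∀ W' : Submodule D V, (∀ w ∈ W', T w ∈ W') → W' ≠ ⊥ →
      Module.finrank D W ≤ Module.finrank D W') :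
    ∃ U : Submodule D V, (∀ u ∈ U, T u ∈ U) ∧ Module.finrank D W ∣ Module.finrank D U ∧
      ∀ W' : Submodule D V, (∀ w ∈ W', T w ∈ W') →
        Module.finrank D W' = Module.finrank D W → W' ≤ U := by
  let S : Set (Submodule D V) :=
    {U | (∀ u ∈ U, T u ∈ U) ∧ Module.finrank D W ∣ Module.finrank D U}
  obtain ⟨U, ⟨hUT, hUr⟩, hmax⟩ :=
    WellFounded.has_min (wellFounded_gt (α := Submodule D V)) S ⟨⊥, by simp [S]⟩
  refine ⟨U, hUT, hUr, fun W' hW'T hW' => ?_⟩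
  by_contra hnot
  have hinf : U ⊓ W' = ⊥ := by
    by_contra hne
    have h1 := hmin (U ⊓ W') (fun w hw => ⟨hUT w hw.1, hW'T w hw.2⟩) hne
    have h2 : U ⊓ W' = W' := Submodule.eq_of_le_of_finrank_le inf_le_right (hW'.trans_le h1)
    exact hnot (inf_eq_right.1 h2)
  have hdim := Submodule.finrank_sup_add_finrank_inf_eq U W'
  rw [hinf, finrank_bot, add_zero, hW'] at hdim
  refine hmax (U ⊔ W') ⟨fun u hu => ?_, hdim ▸ hUr.add dvd_rfl⟩ (left_lt_sup.2 hnot)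
  obtain ⟨x, hx, y, hy, rfl⟩ := Submodule.mem_sup.1 hu
  rw [map_add]
  exact Submodule.add_mem_sup (hUT x hx) (hW'T y hy)

end SemilinearEnd

section TwistedShift

variable {D : Type*} [DivisionRing D] (σ : D ≃+* D) (d : D) (n : ℕ)

/-- Left multiplication by `t` on `D[t;σ] / D[t;σ](t^{n+1} - d)`, in the basis `1, t, …, t^n`. -/
def twistedShift : AddMonoid.End (Fin (n + 1) → D) where
  toFun v := Fin.cons (σ (v (Fin.last n)) * d) fun i : Fin n => σ (v i.castSucc)
  map_zero' := by
    ext i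
    refine Fin.cases ?_ (fun i => ?_) i <;> simp
  map_add' v w := by
    ext i
    refine Fin.cases ?_ (fun i => ?_) i <;> simp [add_mul]

variable {n}

theorem twistedShift_apply_zero (v : Fin (n + 1) → D) :
    twistedShift σ d n v 0 = σ (v (Fin.last n)) * d := rfl

theorem twistedShift_apply_succ (v : Fin (n + 1) → D) (i : Fin n) :
    twistedShift σ d n v i.succ = σ (v i.castSucc) := rfl

theorem twistedShift_smul (a : D) (v : Fin (n + 1) → D) :
    twistedShift σ d n (a • v) = σ a • twistedShift σ d n v := by
  ext i
  refine Fin.cases ?_ (fun i => ?_) i <;>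
    simp [twistedShift_apply_zero, twistedShift_apply_succ, mul_assoc]

theorem twistedShift_single_castSucc (i : Fin n) :
    twistedShift σ d n (Pi.single i.castSucc 1) = Pi.single i.succ 1 := by
  ext j
  refine Fin.cases ?_ (fun j => ?_) j
  · simp [twistedShift_apply_zero, (Fin.castSucc_lt_last i).ne',
      (Fin.succ_ne_zero i).symm]
  · simp [twistedShift_apply_succ, Pi.single_apply, apply_ite σ]

theorem twistedShift_single_last :
    twistedShift σ d n (Pi.single (Fin.last n) 1) = d • Pi.single 0 1 := by
  ext j
  refine Fin.cases ?_ (fun j => ?_) j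
  · simp [twistedShift_apply_zero]
  · simp [twistedShift_apply_succ, (Fin.castSucc_lt_last j).ne]

theorem twistedShift_pow_single_zero (i : Fin (n + 1)) :
    (twistedShift σ d n ^ (i : ℕ)) (Pi.single 0 1) = Pi.single i 1 := by
  induction i using Fin.induction with
  | zero => simp
  | succ i ih =>
    rw [Fin.val_castSucc] at ih
    rw [Fin.val_succ, pow_succ', AddMonoid.End.coe_mul, Function.comp_apply, ih,
      twistedShift_single_castSucc]

theorem twistedShift_pow_succ_single_zero :
    (twistedShift σ d n ^ (n + 1)) (Pi.single 0 1) = d • Pi.single 0 1 := by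
  have := twistedShift_pow_single_zero σ d (Fin.last n)
  rw [Fin.val_last] at this
  rw [pow_succ', AddMonoid.End.coe_mul, Function.comp_apply, this, twistedShift_single_last]

theorem linearCombination_twistedShift_ne_zero {h : ℕ →₀ D} (h0 : h ≠ 0)
    (hdeg : tDeg h < (n + 1 : ℕ)) :
    Finsupp.linearCombination D (fun i => (twistedShift σ d n ^ i) (Pi.single 0 1)) h ≠ 0 := by
  have hlt : ∀ i ∈ h.support, i < n + 1 := fun i hi => by
    have := (Finset.le_max hi).trans_lt hdeg
    rwa [Nat.cast_withBot, WithBot.coe_lt_coe] at this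
  obtain ⟨j, hj⟩ := Finsupp.support_nonempty_iff.2 h0
  intro hzero
  have := congrFun hzero ⟨j, hlt j hj⟩
  rw [Finsupp.linearCombination_apply, Finsupp.sum, Finset.sum_apply,
    Finset.sum_eq_single_of_mem j hj] at this
  · have h2 := twistedShift_pow_single_zero σ d ⟨j, hlt j hj⟩
    simp only at h2
    rw [h2] at this
    simp at this
    exact Finsupp.mem_support_iff.1 hj this
  · intro i hi hij
    have h2 := twistedShift_pow_single_zero σ d ⟨i, hlt i hi⟩
    simp only at h2
    rw [h2]
    simp [hij.symm]

theorem eq_top_of_single_mem {U : Submodule D (Fin (n + 1) → D)} (hd : d ≠ 0)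
    (hU : ∀ u ∈ U, twistedShift σ d n u ∈ U) {i : Fin (n + 1)}
    (hi : (Pi.single i 1 : Fin (n + 1) → D) ∈ U) : U = ⊤ := by
  have hlast : (Pi.single (Fin.last n) 1 : Fin (n + 1) → D) ∈ U := by
    induction i using Fin.reverseInduction with
    | last => exact hi
    | cast i ih => exact ih (twistedShift_single_castSucc σ d i ▸ hU _ hi)
  have hzero : (Pi.single 0 1 : Fin (n + 1) → D) ∈ U := by
    rw [← U.smul_mem_iff hd, ← twistedShift_single_last σ d]
    exact hU _ hlast
  have hall : ∀ j, (Pi.single j 1 : Fin (n + 1) → D) ∈ U := fun j => by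
    induction j using Fin.induction with
    | zero => exact hzero
    | succ j ih => exact twistedShift_single_castSucc σ d j ▸ hU _ ih
  rw [eq_top_iff]
  intro v _
  rw [pi_eq_sum_univ' v]
  refine U.sum_mem fun j _ => U.smul_mem _ ?_
  convert hall j using 1

theorem eq_twistedNorm_of_eigenvector (hd : d ≠ 0) {v : Fin (n + 1) → D} (hv : v ≠ 0) {c : D}
    (hc : twistedShift σ d n v = c • v) : ∃ z, d = twistedNorm σ z (n + 1) := by
  have hv0 : v 0 ≠ 0 := by
    intro h0
    refine hv (funext fun i => ?_)
    by_cases hc0 : c = 0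
    · subst hc0
      refine Fin.lastCases ?_ (fun i => ?_) i
      · have := congrFun hc 0
        simpa [twistedShift_apply_zero, hd] using this
      · have := congrFun hc i.succ
        simpa [twistedShift_apply_succ] using this
    · induction i using Fin.induction with
      | zero => exact h0
      | succ i ih =>
        have := congrFun hc i.succ
        simpa [twistedShift_apply_succ, ih, hc0] using this
  obtain ⟨w, hw⟩ : ∃ w, w = (v 0)⁻¹ • v := ⟨_, rfl⟩
  obtain ⟨z, hz⟩ : ∃ z, z = σ (v 0)⁻¹ * c * v 0 := ⟨_, rfl⟩
  have hw0 : w 0 = 1 := by simp [hw, hv0]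
  have hwz : twistedShift σ d n w = z • w := by
    rw [hw, hz, twistedShift_smul, hc, smul_smul, smul_smul, mul_assoc, mul_assoc,
      mul_inv_cancel₀ hv0, mul_one]
  have key : ∀ i : Fin (n + 1), twistedNorm σ z i * w i = 1 := fun i => by
    induction i using Fin.induction with
    | zero => simp [twistedNorm_zero, hw0]
    | succ i ih =>
      have := congrFun hwz i.succ
      rw [twistedShift_apply_succ, Pi.smul_apply, smul_eq_mul] at this
      rw [Fin.val_succ, twistedNorm_succ', mul_assoc, ← this, ← map_mul]
      rw [Fin.val_castSucc] at ih
      rw [ih, map_one]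
  refine ⟨z, ?_⟩
  have h1 := congrFun hwz 0
  rw [twistedShift_apply_zero, Pi.smul_apply, smul_eq_mul, hw0, mul_one] at h1
  have h2 := key (Fin.last n)
  rw [Fin.val_last] at h2
  calc
    d = σ (twistedNorm σ z n * w (Fin.last n)) * d := by rw [h2, map_one, one_mul]
    _ = twistedNorm σ z (n + 1) := by rw [map_mul, mul_assoc, h1, twistedNorm_succ']

end TwistedShift

section Twist

variable {D : Type*} [DivisionRing D] (ζ : D) (n : ℕ)

/-- The linear map scaling the `i`-th coordinate by `ζ ^ i` on the right. -/
def rootTwist : Module.End D (Fin (n + 1) → D) where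
  toFun v i := v i * ζ ^ (i : ℕ)
  map_add' v w := by ext i; simp [add_mul]
  map_smul' a v := by ext i; simp [mul_assoc]

variable {ζ n}

theorem rootTwist_apply (v : Fin (n + 1) → D) (i : Fin (n + 1)) :
    rootTwist ζ n v i = v i * ζ ^ (i : ℕ) := rfl

theorem rootTwist_injective (hζ : ζ ≠ 0) : Function.Injective (rootTwist ζ n) := by
  intro v w h
  ext i
  have := congrFun h i
  rwa [rootTwist_apply, rootTwist_apply, mul_left_inj' (pow_ne_zero _ hζ)] at this

theorem rootTwist_twistedShift {σ : D ≃+* D} {d : D} (hζcen : ζ ∈ Subring.center D)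
    (hζfix : σ ζ = ζ) (hζpow : ζ ^ (n + 1) = 1) (v : Fin (n + 1) → D) :
    rootTwist ζ n (twistedShift σ d n v) = ζ • twistedShift σ d n (rootTwist ζ n v) := by
  have hcomm : ∀ (k : ℕ) (x : D), x * ζ ^ k = ζ ^ k * x :=
    fun k x => Subring.mem_center_iff.1 (Subring.pow_mem _ hζcen k) x
  ext i
  refine Fin.cases ?_ (fun i => ?_) i
  · simp only [rootTwist_apply, Pi.smul_apply, smul_eq_mul, twistedShift_apply_zero, map_mul,
      map_pow, hζfix, Fin.val_last, Fin.val_zero, pow_zero, mul_one]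
    rw [hcomm, ← mul_assoc, ← mul_assoc, ← pow_succ', hζpow, one_mul]
  · simp only [rootTwist_apply, Pi.smul_apply, smul_eq_mul, twistedShift_apply_succ, map_mul,
      map_pow, hζfix, Fin.val_succ, Fin.val_castSucc]
    rw [hcomm, hcomm, ← mul_assoc, ← pow_succ']

theorem map_rootTwist_invariant {σ : D ≃+* D} {d : D} (hζ : ζ ≠ 0)
    (hζcen : ζ ∈ Subring.center D) (hζfix : σ ζ = ζ) (hζpow : ζ ^ (n + 1) = 1)
    {W : Submodule D (Fin (n + 1) → D)} (hW : ∀ w ∈ W, twistedShift σ d n w ∈ W) :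
    ∀ w ∈ W.map (rootTwist ζ n), twistedShift σ d n w ∈ W.map (rootTwist ζ n) := by
  rintro _ ⟨w, hw, rfl⟩
  rw [← Submodule.smul_mem_iff _ hζ, ← rootTwist_twistedShift hζcen hζfix hζpow]
  exact Submodule.mem_map_of_mem (hW w hw)

/-- A nonzero subspace stable under `rootTwist ζ n` contains a standard basis vector. -/
theorem exists_single_mem_of_rootTwist_stable (hζcen : ζ ∈ Subring.center D)
    (hinj : ∀ i j : Fin (n + 1), ζ ^ (i : ℕ) = ζ ^ (j : ℕ) → i = j)
    {S : Submodule D (Fin (n + 1) → D)} (hS : ∀ s ∈ S, rootTwist ζ n s ∈ S) (hne : S ≠ ⊥) :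
    ∃ i, (Pi.single i 1 : Fin (n + 1) → D) ∈ S := by
  classical
  have hcomm : ∀ (k : ℕ) (x : D), x * ζ ^ k = ζ ^ k * x :=
    fun k x => Subring.mem_center_iff.1 (Subring.pow_mem _ hζcen k) x
  let supp : (Fin (n + 1) → D) → Finset (Fin (n + 1)) := fun v => {i | v i ≠ 0}
  obtain ⟨w₀, hw₀, hw₀ne⟩ := Submodule.exists_mem_ne_zero_of_ne_bot hne
  obtain ⟨w, ⟨hwS, hw0⟩, hmin⟩ := WellFounded.has_min
    (InvImage.wf (fun v => (supp v).card) (wellFounded_lt (α := ℕ)))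
    {v | v ∈ S ∧ v ≠ 0} ⟨w₀, hw₀, hw₀ne⟩
  obtain ⟨i, hi⟩ := Function.ne_iff.1 hw0
  rw [Pi.zero_apply] at hi
  have honly : ∀ j, j ≠ i → w j = 0 := by
    intro j hji
    by_contra hj
    have hcoord : ∀ k, (rootTwist ζ n w - ζ ^ (i : ℕ) • w) k =
        w k * (ζ ^ (k : ℕ) - ζ ^ (i : ℕ)) := fun k => by
      rw [Pi.sub_apply, rootTwist_apply, Pi.smul_apply, smul_eq_mul, ← hcomm, mul_sub]
    refine hmin (rootTwist ζ n w - ζ ^ (i : ℕ) • w)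
      ⟨S.sub_mem (hS w hwS) (S.smul_mem _ hwS), fun h => ?_⟩ ?_
    · have := congrFun h j
      rw [hcoord, Pi.zero_apply, mul_eq_zero, sub_eq_zero] at this
      exact this.elim hj fun h => hji (hinj j i h)
    · refine Finset.card_lt_card ⟨fun k hk => ?_, fun hsub => ?_⟩
      · simp only [supp, Finset.mem_filter_univ, hcoord] at hk ⊢
        exact left_ne_zero_of_mul hk
      · have := @hsub i (by simpa [supp] using hi)
        simp only [supp, Finset.mem_filter_univ, hcoord] at this
        simp at this
  refine ⟨i, ?_⟩
  rw [← S.smul_mem_iff hi]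
  convert hwS using 1
  ext j
  by_cases hji : j = i
  · subst hji; simp
  · simp [hji, honly j hji]

end Twist

theorem exists_twistedNorm_of_invariant {D : Type*} [DivisionRing D] {σ : D ≃+* D} {d : D}
    (hd : d ≠ 0) {n : ℕ} (hm : (n + 1).Prime) {ζ : D} (hζcen : ζ ∈ Subring.center D)
    (hζfix : σ ζ = ζ) (hζpow : ζ ^ (n + 1) = 1)
    (hinj : ∀ i j : Fin (n + 1), ζ ^ (i : ℕ) = ζ ^ (j : ℕ) → i = j)
    {W₀ : Submodule D (Fin (n + 1) → D)} (hW₀T : ∀ w ∈ W₀, twistedShift σ d n w ∈ W₀)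
    (hW₀ : W₀ ≠ ⊥) (hrank : Module.finrank D W₀ < n + 1) :
    ∃ z, d = twistedNorm σ z (n + 1) := by
  have hζ : ζ ≠ 0 := by
    rintro rfl
    simp at hζpow
  obtain ⟨W, ⟨hWT, hW⟩, hmin⟩ := WellFounded.has_min
    (InvImage.wf (fun W : Submodule D (Fin (n + 1) → D) => Module.finrank D W)
      (wellFounded_lt (α := ℕ)))
    {W | (∀ w ∈ W, twistedShift σ d n w ∈ W) ∧ W ≠ ⊥} ⟨W₀, hW₀T, hW₀⟩
  have hmin' : ∀ W' : Submodule D (Fin (n + 1) → D), (∀ w ∈ W', twistedShift σ d n w ∈ W') →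
      W' ≠ ⊥ → Module.finrank D W ≤ Module.finrank D W' :=
    fun W' h1 h2 => not_lt.1 (hmin W' ⟨h1, h2⟩)
  obtain ⟨U, hUT, hUr, hU⟩ := exists_invariant_dvd_finrank hmin'
  have hconj : ∀ k : ℕ, (∀ w ∈ W.map (rootTwist ζ n ^ k),
      twistedShift σ d n w ∈ W.map (rootTwist ζ n ^ k)) ∧
      Module.finrank D (W.map (rootTwist ζ n ^ k)) = Module.finrank D W := fun k => by
    induction k with
    | zero => rw [pow_zero, Module.End.one_eq_id, Submodule.map_id]; exact ⟨hWT, rfl⟩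
    | succ k ih =>
      rw [pow_succ', Module.End.mul_eq_comp, Submodule.map_comp]
      exact ⟨map_rootTwist_invariant hζ hζcen hζfix hζpow ih.1,
        (LinearEquiv.finrank_eq (Submodule.equivMapOfInjective _
          (rootTwist_injective hζ) _)).symm.trans ih.2⟩
  let S : Submodule D (Fin (n + 1) → D) := ⨅ k : ℕ, U.comap (rootTwist ζ n ^ k)
  have hmemS : ∀ v, v ∈ S ↔ ∀ k : ℕ, (rootTwist ζ n ^ k) v ∈ U := fun v => by
    simp [S, Submodule.mem_iInf]
  have hWS : W ≤ S := fun w hw => (hmemS w).2 fun k =>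
    hU _ (hconj k).1 (hconj k).2 (Submodule.mem_map_of_mem hw)
  obtain ⟨i, hi⟩ := exists_single_mem_of_rootTwist_stable hζcen hinj (S := S)
    (fun s hs => (hmemS _).2 fun k => by
      rw [← Module.End.mul_apply, ← pow_succ]
      exact (hmemS s).1 hs (k + 1))
    (fun h => hW (le_bot_iff.1 (h ▸ hWS)))
  have htop : U = ⊤ := eq_top_of_single_mem σ d hd hUT (by simpa using (hmemS _).1 hi 0)
  rw [htop, finrank_top, Module.finrank_fin_fun] at hUr
  have hone : Module.finrank D W = 1 := by
    refine ((Nat.dvd_prime hm).1 hUr).resolve_right fun h => ?_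
    have := hmin' W₀ hW₀T hW₀
    omega
  obtain ⟨⟨v, hvW⟩, hv0, hv⟩ := finrank_eq_one_iff'.1 hone
  obtain ⟨c, hc⟩ := hv ⟨_, hWT v hvW⟩
  exact eq_twistedNorm_of_eigenvector σ d hd (fun h => hv0 (Subtype.ext h))
    (congrArg Subtype.val hc).symm

/-- Suppose `m` is prime and the intersection of the center of `D` with the
fixed ring of `σ` contains a primitive `m`-th root of unity `ζ`. Then `f(t) = t^m − d` is
irreducible in `D[t;σ]` iff `d ≠ σ^{m−1}(z)⋯σ(z)·z` for all `z ∈ D`. -/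
theorem prime_degree_irreducible_iff {D : Type*} [DivisionRing D] (σ : D ≃+* D) (d : D)
    (m : ℕ) (hm : m.Prime) (ζ : D) (hζcen : ζ ∈ Subring.center D) (hζfix : σ ζ = ζ)
    (hζpow : ζ ^ m = 1) (hζprim : ∀ k : ℕ, 0 < k → k < m → ζ ^ k ≠ 1) :
    tIrred σ (Finsupp.single m (1 : D) - Finsupp.single 0 d) ↔
      ∀ z : D, d ≠ ((List.range m).reverse.map fun i => (σ ^ i) z).prod := by
  have hdeg := tDeg_single_sub hm.ne_zero d
  change _ ↔ ∀ z : D, d ≠ twistedNorm σ z m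
  constructor
  · rintro hirr z rfl
    obtain ⟨q, hq, hmul⟩ := exists_tMul_eq_single_sub_twistedNorm σ z m
    refine hirr ⟨q, _, hq.trans_eq hdeg.symm, ?_, hmul.symm⟩
    rw [hdeg, tDeg_single_sub one_ne_zero]
    exact_mod_cast hm.one_lt
  · rintro hnorm ⟨g, h, hg, hh, hgh⟩
    rw [hdeg] at hg hh
    obtain ⟨n, rfl⟩ := Nat.exists_eq_succ_of_ne_zero hm.ne_zero
    have hd : d ≠ 0 := by
      rintro rfl
      exact hnorm 0 (by rw [Nat.succ_eq_add_one, twistedNorm_succ', mul_zero])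
    have hf : tMul σ g h ≠ 0 := by
      intro h0
      rw [← hgh] at h0
      simpa using DFunLike.congr_fun h0 (n + 1)
    have hg0 : g ≠ 0 := by
      rintro rfl
      exact hf (by simp [tMul])
    have hh0 : h ≠ 0 := by
      rintro rfl
      exact hf (by simp [tMul])
    have hinj : ∀ i j : Fin (n + 1), ζ ^ (i : ℕ) = ζ ^ (j : ℕ) → i = j := by
      have hord : orderOf ζ = n + 1 :=
        (orderOf_eq_iff n.succ_pos).2 ⟨hζpow, fun k hk hk0 => hζprim k hk0 hk⟩
      exact fun i j hij => Fin.ext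
        (pow_injOn_Iio_orderOf (i.2.trans_eq hord.symm) (j.2.trans_eq hord.symm) hij)
    have hzero := linearCombination_tMul (twistedShift_smul σ d (n := n)) g h (Pi.single 0 1)
    rw [← hgh, map_sub, Finsupp.linearCombination_single, Finsupp.linearCombination_single,
      Nat.succ_eq_add_one, twistedShift_pow_succ_single_zero, one_smul, pow_zero,
      AddMonoid.End.one_apply, sub_self] at hzero
    obtain ⟨W, hWT, hW, hrank⟩ := exists_invariant_of_linearCombination_eq_zero
      (twistedShift_smul σ d) hg0 hg (linearCombination_twistedShift_ne_zero σ d hh0 hh)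
      hzero.symm
    obtain ⟨z, hz⟩ := exists_twistedNorm_of_invariant hd hm hζcen hζfix hζpow hinj hWT hW hrank
    exact hnorm z hz
end

section
/- Suppose D = (K/F,σ,c) is a division algebra. Then the tensor product algebra A = (L/F₀,σ,c) ⊗_{F₀} (F/F₀,τ,d) is a division algebra if and only if the twisted polynomial f(t) = t^m − d is irreducible in D[t; τ̃^{−1}]. -/
/-!
Setup: `K` is a field, `σ τ : K ≃+* K` are commuting automorphisms of orders `n`, `m`
generating a group of order `n*m` (encoded by `hindep`); `F = Fix σ`, `L = Fix τ`,
`F₀ = Fix σ ∩ Fix τ`, so that `K/F₀` is Galois with group `⟨σ⟩ × ⟨τ⟩`.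

`cycMul` is the multiplication of the associative cyclic algebra `D = (K/F,σ,c)` of degree `n`,
realized on `Fin n → K` (the coefficients w.r.t. the right `K`-basis `{1, e, …, e^{n-1}}`),
via `(eⁱ a)(eᵏ b) = e^{(i+k) % n} c^{(i+k)/n} σᵏ(a) b`.

`tenMul` is the multiplication of the tensor product algebra
`A = (L/F₀,σ,c) ⊗_{F₀} (F/F₀,τ,d)`, realized on `Fin n → Fin m → K`
(the coefficients w.r.t. the `K`-basis `{eⁱ fʲ}`), via
`(eⁱfʲ a)(eᵏfˡ b) = e^{(i+k) % n} f^{(j+l) % m} c^{(i+k)/n} d^{(j+l)/m} σᵏ(τˡ(a)) b`.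
-/

/-- Multiplication of the cyclic algebra `(K/F,σ,c)` on coefficients `Fin n → K`. -/
noncomputable def cycMul {K : Type*} [Field K] (n : ℕ) (σ : K ≃+* K) (c : K)
    (x y : Fin n → K) : Fin n → K :=
  fun r => ∑ i : Fin n, ∑ k : Fin n,
    if ((i : ℕ) + (k : ℕ)) % n = (r : ℕ) then
      c ^ (((i : ℕ) + (k : ℕ)) / n) * (σ ^ (k : ℕ)) (x i) * y k
    else 0

/-- Multiplication of the tensor product algebra `(L/F₀,σ,c) ⊗_{F₀} (F/F₀,τ,d)` on
coefficients `Fin n → Fin m → K`. -/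
noncomputable def tenMul {K : Type*} [Field K] (n m : ℕ) (σ τ : K ≃+* K) (c d : K)
    (x y : Fin n → Fin m → K) : Fin n → Fin m → K :=
  fun r s => ∑ i : Fin n, ∑ j : Fin m, ∑ k : Fin n, ∑ l : Fin m,
    if ((i : ℕ) + (k : ℕ)) % n = (r : ℕ) ∧ ((j : ℕ) + (l : ℕ)) % m = (s : ℕ) then
      c ^ (((i : ℕ) + (k : ℕ)) / n) * d ^ (((j : ℕ) + (l : ℕ)) / m) *
        (σ ^ (k : ℕ)) ((τ ^ (l : ℕ)) (x i j)) * y k l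
    else 0

/-- The scalar `d ∈ K` viewed as the element `e⁰ d` of the cyclic algebra. -/
noncomputable def delta0 {K : Type*} [Field K] (n : ℕ) (d : K) : Fin n → K :=
  fun i => if (i : ℕ) = 0 then d else 0

/-- The (left-associated) product `z · τ̃(z) · τ̃²(z) ⋯ τ̃^{j-1}(z)` in the cyclic algebra
`D = (K/F,σ,c)`, where `τ̃` applies `τ` to each `K`-coefficient. -/
noncomputable def zProd {K : Type*} [Field K] (n : ℕ) (σ τ : K ≃+* K) (c : K)
    (z : Fin n → K) : ℕ → (Fin n → K)
  | 0 => delta0 n 1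
  | (j + 1) => cycMul n σ c (zProd n σ τ c z j) (fun i => (τ ^ j) (z i))

/-- Multiplication of the twisted polynomial ring `D[t;τ̃⁻¹]` over the cyclic algebra
`D = (K/F,σ,c)`; polynomials are modeled as finitely supported left-coefficient functions
`ℕ →₀ (Fin n → K)`, and `(a tⁱ)(b tʲ) = a · τ̃⁻ⁱ(b) · t^{i+j}` (product of coefficients in
`D`), where `τ̃` applies `τ` to each `K`-coefficient. -/
noncomputable def skewMul {K : Type*} [Field K] (n : ℕ) (σ τ : K ≃+* K) (c : K)
    (f g : ℕ →₀ (Fin n → K)) : ℕ →₀ (Fin n → K) :=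
  f.sum fun i a => g.sum fun j b =>
    Finsupp.single (i + j) (cycMul n σ c a (fun r => (τ.symm ^ i) (b r)))

/-- A twisted polynomial of positive degree over `D` is irreducible iff it admits no
factorization `f = g * h` with `deg g < deg f` and `deg h < deg f`. -/
def skewIrred {K : Type*} [Field K] (n : ℕ) (σ τ : K ≃+* K) (c : K)
    (f : ℕ →₀ (Fin n → K)) : Prop :=
  ¬ ∃ g h : ℕ →₀ (Fin n → K), g.support.max < f.support.max ∧
      h.support.max < f.support.max ∧ f = skewMul n σ τ c g h

namespace SkewPolynomial

/-- The left `R`-submodule of skew polynomials all of whose coefficients of index at least `k`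
vanish. -/
def degLT (R : Type*) [Semiring R] (k : ℕ) : Submodule R (SkewPolynomial R) where
  carrier := {p | ∀ i, k ≤ i → p.coeff i = 0}
  add_mem' {a b} ha hb i hi := by simp [ha i hi, hb i hi]
  zero_mem' _ _ := rfl
  smul_mem' r p hp i hi := by
    have := hp i hi
    simp only [SkewPolynomial.coeff, SkewMonoidAlgebra.coeff_smul, Finsupp.smul_apply] at this ⊢
    rw [this, smul_zero]

theorem mem_degLT {R : Type*} [Semiring R] {k : ℕ} {p : SkewPolynomial R} :
    p ∈ degLT R k ↔ ∀ i, k ≤ i → p.coeff i = 0 :=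
  Iff.rfl

theorem degLT_mono {R : Type*} [Semiring R] {k l : ℕ} (h : k ≤ l) : degLT R k ≤ degLT R l :=
  fun _ hp i hi => hp i (h.trans hi)

theorem monomial_mem_degLT {R : Type*} [Semiring R] {i k : ℕ} (h : i < k) (a : R) :
    monomial i a ∈ degLT R k := by
  intro j hj
  rw [coeff_monomial, if_neg (by omega)]

theorem exists_mem_degLT {R : Type*} [Semiring R] (p : SkewPolynomial R) :
    ∃ k, p ∈ degLT R k := by
  refine ⟨p.support.sup id + 1, fun i hi => ?_⟩
  by_contra h
  have : i ≤ p.support.sup id := Finset.le_sup (f := id) (mem_support_iff.2 h)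
  omega

/-- A nonzero skew polynomial in `degLT R k` has a leading coefficient. -/
theorem exists_leading {R : Type*} [Semiring R] {k : ℕ} {p : SkewPolynomial R}
    (hp : p ∈ degLT R k) (h0 : p ≠ 0) : ∃ a < k, p ∈ degLT R (a + 1) ∧ p.coeff a ≠ 0 := by
  induction k with
  | zero => exact absurd (SkewPolynomial.ext fun i => hp i (Nat.zero_le i)) h0
  | succ k ih =>
    by_cases h : p.coeff k = 0
    · obtain ⟨a, ha, h1⟩ := ih fun i hi => by
        rcases hi.eq_or_lt with rfl | hi
        · exact h
        · exact hp i hi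
      exact ⟨a, by omega, h1⟩
    · exact ⟨k, by omega, hp, h⟩

theorem coeff_finset_sum {R ι : Type*} [Semiring R] (s : Finset ι) (p : ι → SkewPolynomial R)
    (n : ℕ) : (∑ i ∈ s, p i).coeff n = ∑ i ∈ s, (p i).coeff n :=
  map_sum (⟨⟨fun p : SkewPolynomial R => p.coeff n, rfl⟩,
    fun p q => coeff_add p q n⟩ : SkewPolynomial R →+ R) p s

/-- The skew polynomial with prescribed coefficients of index less than `k`. -/
noncomputable def ofFin (R : Type*) [Semiring R] (k : ℕ) : (Fin k → R) →ₗ[R] SkewPolynomial R :=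
  ∑ i : Fin k, (monomial (i : ℕ)).comp (LinearMap.proj i)

theorem ofFin_apply {R : Type*} [Semiring R] (k : ℕ) (v : Fin k → R) :
    ofFin R k v = ∑ i : Fin k, monomial (i : ℕ) (v i) := by
  simp [ofFin]

theorem ofFin_mem {R : Type*} [Semiring R] (k : ℕ) (v : Fin k → R) : ofFin R k v ∈ degLT R k := by
  rw [ofFin_apply]
  exact sum_mem fun i _ => monomial_mem_degLT i.2 _

theorem coeff_ofFin {R : Type*} [Semiring R] (k : ℕ) (v : Fin k → R) (i : Fin k) :
    (ofFin R k v).coeff i = v i := by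
  simp [ofFin_apply, coeff_finset_sum, coeff_monomial, Fin.val_inj]

theorem ofFin_coeff {R : Type*} [Semiring R] {k : ℕ} {p : SkewPolynomial R}
    (hp : p ∈ degLT R k) : ofFin R k (fun i => p.coeff i) = p := by
  ext i
  by_cases hi : i < k
  · exact coeff_ofFin k _ ⟨i, hi⟩
  · rw [hp i (by omega), ofFin_mem k _ i (by omega)]

section Semiring

variable {R : Type*} [Semiring R] [MulSemiringAction (Multiplicative ℕ) R]

theorem coeff_mul_antidiagonal (p q : SkewPolynomial R) (N : ℕ) :
    (p * q).coeff N =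
      ∑ x ∈ Finset.HasAntidiagonal.antidiagonal N, p.coeff x.1 * φ^[x.1] (q.coeff x.2) := by
  simp only [φ_iterate_apply]
  refine (SkewMonoidAlgebra.coeff_mul_antidiagonal_of_finset p q (Multiplicative.ofAdd N)
    ((Finset.HasAntidiagonal.antidiagonal N).map
      (Multiplicative.ofAdd.toEmbedding.prodMap Multiplicative.ofAdd.toEmbedding)) ?_).trans ?_
  · intro x
    simp only [Finset.mem_map, Finset.HasAntidiagonal.mem_antidiagonal, Prod.exists]
    constructor
    · rintro ⟨a, b, h, rfl⟩
      exact congrArg Multiplicative.ofAdd h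
    · intro h
      exact ⟨x.1.toAdd, x.2.toAdd, congrArg Multiplicative.toAdd h, rfl⟩
  · rw [Finset.sum_map]
    rfl

theorem mul_mem_degLT {a b : ℕ} {p q : SkewPolynomial R} (hp : p ∈ degLT R (a + 1))
    (hq : q ∈ degLT R (b + 1)) : p * q ∈ degLT R (a + b + 1) := by
  intro i hi
  rw [coeff_mul_antidiagonal]
  refine Finset.sum_eq_zero fun x hx => ?_
  rw [Finset.HasAntidiagonal.mem_antidiagonal] at hx
  by_cases h : a + 1 ≤ x.1
  · rw [hp _ h, zero_mul]
  · rw [hq x.2 (by omega), iterate_map_zero, mul_zero]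

theorem coeff_mul_add {a b : ℕ} {p q : SkewPolynomial R} (hp : p ∈ degLT R (a + 1))
    (hq : q ∈ degLT R (b + 1)) :
    (p * q).coeff (a + b) = p.coeff a * φ^[a] (q.coeff b) := by
  rw [coeff_mul_antidiagonal, Finset.sum_eq_single (a, b)]
  · intro x hx hne
    rw [Finset.HasAntidiagonal.mem_antidiagonal] at hx
    by_cases h : a + 1 ≤ x.1
    · rw [hp _ h, zero_mul]
    · rw [hq x.2, iterate_map_zero, mul_zero]
      by_contra h'
      exact hne (Prod.ext (by simp; omega) (by simp; omega))
  · simp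

end Semiring

section DivisionRing

variable {D : Type*} [DivisionRing D] [MulSemiringAction (Multiplicative ℕ) D]

theorem φ_iterate_ne_zero (i : ℕ) {a : D} (ha : a ≠ 0) : φ^[i] a ≠ 0 := by
  induction i with
  | zero => exact ha
  | succ i ih =>
    rw [Function.iterate_succ_apply']
    exact (map_ne_zero _).2 ih

theorem coeff_mul_add_ne_zero {a b : ℕ} {p q : SkewPolynomial D} (hp : p ∈ degLT D (a + 1))
    (hq : q ∈ degLT D (b + 1)) (ha : p.coeff a ≠ 0) (hb : q.coeff b ≠ 0) :
    (p * q).coeff (a + b) ≠ 0 := by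
  rw [coeff_mul_add hp hq]
  exact mul_ne_zero ha (φ_iterate_ne_zero a hb)

theorem eq_zero_of_mul_mem_degLT {k : ℕ} {f q : SkewPolynomial D} (hf : f ∈ degLT D (k + 1))
    (hk : f.coeff k ≠ 0) (h : q * f ∈ degLT D k) : q = 0 := by
  by_contra hq
  obtain ⟨N, hN⟩ := exists_mem_degLT q
  obtain ⟨a, -, h1, h2⟩ := exists_leading hN hq
  exact coeff_mul_add_ne_zero h1 hf h2 hk (h _ (by omega))

/-- Right division with remainder. -/
theorem exists_sub_mul_mem_degLT {k : ℕ} {h : SkewPolynomial D} (hh : h ∈ degLT D (k + 1))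
    (hk : h.coeff k ≠ 0) (g : SkewPolynomial D) : ∃ q, g - q * h ∈ degLT D k := by
  obtain ⟨N, hN⟩ := exists_mem_degLT g
  induction N generalizing g with
  | zero => exact ⟨0, by simpa using degLT_mono (Nat.zero_le k) hN⟩
  | succ N ih =>
    by_cases hNk : N < k
    · exact ⟨0, by simpa using degLT_mono hNk hN⟩
    obtain ⟨j, rfl⟩ : ∃ j, N = j + k := ⟨N - k, by omega⟩
    set u : SkewPolynomial D := monomial j (g.coeff (j + k) * (φ^[j] (h.coeff k))⁻¹) with hu
    have hum : u ∈ degLT D (j + 1) := monomial_mem_degLT (Nat.lt_succ_self j) _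
    obtain ⟨q, hq⟩ := ih (g - u * h) fun i hi => by
      rw [coeff_sub]
      rcases hi.eq_or_lt with rfl | hi
      · rw [coeff_mul_add hum hh, hu, coeff_monomial, if_pos rfl,
          inv_mul_cancel_right₀ (φ_iterate_ne_zero j hk), sub_self]
      · rw [hN i hi, mul_mem_degLT hum hh i hi, sub_zero]
    exact ⟨q + u, by rwa [add_mul, add_comm, ← sub_sub]⟩

/-- If the left ideals `(f)` and `(h)` are comaximal, where `f` has degree `m`, then no nonzero
`g` of degree less than `m` satisfies `g * h ∈ (f)`. -/
theorem eq_zero_of_mul_mem_span {m : ℕ} {f g h u : SkewPolynomial D} (hf : f ∈ degLT D (m + 1))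
    (hfm : f.coeff m ≠ 0) (hg : g ∈ degLT D m) (hu : 1 - u * h ∈ Ideal.span {f})
    (hgh : g * h ∈ Ideal.span {f}) : g = 0 := by
  by_contra hg0
  obtain ⟨k, hkm, hgk, hk⟩ := exists_leading hg hg0
  let N : Submodule D (SkewPolynomial D) := (Ideal.span {f}).restrictScalars D
  let α : (Fin k → D) →ₗ[D] SkewPolynomial D ⧸ N :=
    N.mkQ ∘ₗ ((LinearMap.toSpanSingleton (SkewPolynomial D) (SkewPolynomial D) h).restrictScalars D)
      ∘ₗ ofFin D k
  let β : (Fin m → D) →ₗ[D] SkewPolynomial D ⧸ N := N.mkQ ∘ₗ ofFin D m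
  have hα : Function.Surjective α := by
    intro w
    obtain ⟨w, rfl⟩ := N.mkQ_surjective w
    obtain ⟨q, hq⟩ := exists_sub_mul_mem_degLT hgk hk (w * u)
    refine ⟨fun i => (w * u - q * g).coeff i, ?_⟩
    have e : α (fun i => (w * u - q * g).coeff i) = N.mkQ ((w * u - q * g) * h) := by
      simp only [α, LinearMap.comp_apply, LinearMap.restrictScalars_apply,
        LinearMap.toSpanSingleton_apply, smul_eq_mul]
      rw [ofFin_coeff hq]
    rw [e, ← sub_eq_zero, ← map_sub, Submodule.mkQ_apply, Submodule.Quotient.mk_eq_zero]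
    change (w * u - q * g) * h - w ∈ Ideal.span {f}
    have e2 : (w * u - q * g) * h - w = -(w * (1 - u * h)) - q * (g * h) := by noncomm_ring
    rw [e2]
    exact sub_mem (neg_mem (Ideal.mul_mem_left _ _ hu)) (Ideal.mul_mem_left _ _ hgh)
  have hβ : Function.Injective β := by
    rw [← LinearMap.ker_eq_bot, LinearMap.ker_eq_bot']
    intro v hv
    have h1 : ofFin D m v ∈ Ideal.span {f} := by
      simpa [β, Submodule.Quotient.mk_eq_zero, N] using hv
    obtain ⟨q, hq⟩ := Ideal.mem_span_singleton'.1 h1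
    have hq0 := eq_zero_of_mul_mem_degLT hf hfm (hq ▸ ofFin_mem m v)
    funext i
    rw [← coeff_ofFin m v i, ← hq, hq0, zero_mul]
    rfl
  have : Module.Finite D (SkewPolynomial D ⧸ N) := Module.Finite.of_surjective α hα
  have h1 := LinearMap.finrank_le_finrank_of_injective hβ
  have h2 := LinearMap.finrank_le_finrank_of_surjective hα
  simp at h1 h2
  omega

/-- For `f` of degree `m`, the product modulo `f` of skew polynomials of degree less than `m` has
no zero divisors if and only if `f` is irreducible. -/
theorem forall_mul_notMem_span_iff {m : ℕ} {f : SkewPolynomial D} (hf : f ∈ degLT D (m + 1))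
    (hfm : f.coeff m ≠ 0) :
    (∀ g ∈ degLT D m, ∀ h ∈ degLT D m, g ≠ 0 → h ≠ 0 → g * h ∉ Ideal.span {f}) ↔
      ∀ g ∈ degLT D m, ∀ h ∈ degLT D m, f ≠ g * h := by
  constructor
  · intro H g hg h hh e
    have hf0 : f ≠ 0 := by rintro rfl; exact hfm rfl
    refine H g hg h hh ?_ ?_ (e ▸ Ideal.mem_span_singleton_self f)
    · rintro rfl; exact hf0 (by rw [e, zero_mul])
    · rintro rfl; exact hf0 (by rw [e, mul_zero])
  · intro H g hg h hh hg0 hh0 hgh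
    let I : Ideal (SkewPolynomial D) := Ideal.span {h, f}
    have hI : ∃ k, ∃ p ∈ I, p ∈ degLT D (k + 1) ∧ p.coeff k ≠ 0 := by
      obtain ⟨k, -, h1, h2⟩ := exists_leading hh hh0
      exact ⟨k, h, Ideal.subset_span (by simp), h1, h2⟩
    classical
    obtain ⟨p, hpI, hp, hpk⟩ := Nat.find_spec hI
    set k := Nat.find hI with hkdef
    have hkm : k < m := by
      obtain ⟨a, ha, h1, h2⟩ := exists_leading hh hh0
      exact (Nat.find_min' hI ⟨h, Ideal.subset_span (by simp), h1, h2⟩).trans_lt ha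
    obtain ⟨q, hq⟩ := exists_sub_mul_mem_degLT hp hpk f
    have hfq : f = q * p := by
      by_contra hne
      obtain ⟨a, ha, h1, h2⟩ := exists_leading hq (sub_ne_zero.2 hne)
      exact Nat.find_min hI ha ⟨_, sub_mem (Ideal.subset_span (by simp))
        (Ideal.mul_mem_left _ _ hpI), h1, h2⟩
    have hk0 : k = 0 := by
      by_contra hk0
      refine H q (fun i hi => ?_) p (degLT_mono hkm hp) hfq
      by_contra hqi
      obtain ⟨M, hM⟩ := exists_mem_degLT q
      obtain ⟨a, -, h1, h2⟩ := exists_leading hM (by rintro rfl; exact hqi rfl)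
      have hai : i ≤ a := by
        by_contra hlt
        exact hqi (h1 i (by omega))
      exact coeff_mul_add_ne_zero h1 hp h2 hpk (hfq ▸ hf (a + k) (by omega))
    have hpC : p = C (p.coeff 0) := by
      ext i
      rcases i with _ | i
      · simp
      · rw [hp _ (by omega), coeff_C_succ]
    have h1 : (1 : SkewPolynomial D) ∈ I := by
      have := Ideal.mul_mem_left I (C (p.coeff 0)⁻¹) hpI
      rw [hpC, coeff_C_zero, ← C_mul, inv_mul_cancel₀ (hk0 ▸ hpk), C_1] at this
      exact this
    obtain ⟨u, v, huv⟩ := Ideal.mem_span_pair.1 h1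
    refine hg0 (eq_zero_of_mul_mem_span (u := u) hf hfm hg ?_ hgh)
    rw [← huv, add_sub_cancel_left]
    exact Ideal.mul_mem_left _ _ (Ideal.mem_span_singleton_self f)

end DivisionRing

end SkewPolynomial

section CycMul

variable {K : Type*} [Field K] {n : ℕ} {σ : K ≃+* K} {c : K}

theorem cycMul_add (x y z : Fin n → K) :
    cycMul n σ c x (y + z) = cycMul n σ c x y + cycMul n σ c x z := by
  funext r
  simp only [cycMul, Pi.add_apply, ← Finset.sum_add_distrib]
  refine Finset.sum_congr rfl fun i _ => Finset.sum_congr rfl fun k _ => ?_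
  split_ifs <;> ring

theorem add_cycMul (x y z : Fin n → K) :
    cycMul n σ c (x + y) z = cycMul n σ c x z + cycMul n σ c y z := by
  funext r
  simp only [cycMul, Pi.add_apply, ← Finset.sum_add_distrib, map_add]
  refine Finset.sum_congr rfl fun i _ => Finset.sum_congr rfl fun k _ => ?_
  split_ifs <;> ring

theorem cycMul_zero (x : Fin n → K) : cycMul n σ c x 0 = 0 := by
  funext r
  simp [cycMul]

theorem zero_cycMul (x : Fin n → K) : cycMul n σ c 0 x = 0 := by
  funext r
  simp [cycMul]

theorem cycMul_smul (a : K) (x y : Fin n → K) :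
    cycMul n σ c x (a • y) = a • cycMul n σ c x y := by
  funext r
  simp only [cycMul, Pi.smul_apply, smul_eq_mul, Finset.mul_sum]
  refine Finset.sum_congr rfl fun i _ => Finset.sum_congr rfl fun k _ => ?_
  split_ifs <;> ring

theorem cycMul_single (hn : 0 < n) (i k : Fin n) (a b : K) :
    cycMul n σ c (Pi.single i a) (Pi.single k b) =
      Pi.single ⟨((i : ℕ) + k) % n, Nat.mod_lt _ hn⟩
        (c ^ (((i : ℕ) + k) / n) * (σ ^ (k : ℕ)) a * b) := by
  funext r
  simp only [cycMul]
  rw [Finset.sum_eq_single i, Finset.sum_eq_single k]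
  · simp [Pi.single_apply, Fin.ext_iff, eq_comm]
  · intro l _ hl
    simp [hl]
  · simp
  · intro l _ hl
    simp [hl]
  · simp

theorem Pi.single_sum_induction {ι M : Type*} [Fintype ι] [DecidableEq ι] [AddCommMonoid M]
    {P : (ι → M) → Prop} (zero : P 0) (add : ∀ x y, P x → P y → P (x + y))
    (single : ∀ i a, P (Pi.single i a)) (x : ι → M) : P x := by
  rw [← Finset.univ_sum_single x]
  exact Finset.sum_induction _ P add zero fun i _ => single i _

theorem delta0_eq_single (hn : 0 < n) (a : K) : delta0 n a = Pi.single ⟨0, hn⟩ a := by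
  funext r
  simp [delta0, Pi.single_apply, Fin.ext_iff]

theorem cycMul_delta0 (hn : 0 < n) (a : K) (x : Fin n → K) :
    cycMul n σ c x (delta0 n a) = a • x := by
  rw [delta0_eq_single hn]
  induction x using Pi.single_sum_induction with
  | zero => rw [zero_cycMul, smul_zero]
  | add x y hx hy => rw [add_cycMul, hx, hy, smul_add]
  | single i b =>
    rw [cycMul_single hn, ← Pi.single_smul]
    simp [Nat.mod_eq_of_lt i.2, Nat.div_eq_of_lt i.2, mul_comm]

theorem delta0_one_cycMul (hn : 0 < n) (x : Fin n → K) :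
    cycMul n σ c (delta0 n 1) x = x := by
  rw [delta0_eq_single hn]
  induction x using Pi.single_sum_induction with
  | zero => rw [cycMul_zero]
  | add x y hx hy => rw [cycMul_add, hx, hy]
  | single i b =>
    rw [cycMul_single hn]
    simp [Nat.mod_eq_of_lt i.2, Nat.div_eq_of_lt i.2]

theorem RingEquiv.pow_apply_eq_self {x : K} (hx : σ x = x) (k : ℕ) : (σ ^ k) x = x := by
  induction k with
  | zero => rfl
  | succ k ih => rw [pow_succ, RingAut.mul_apply, hx, ih]

theorem cycMul_assoc (hn : 0 < n) (hσ : σ ^ n = 1) (hc : σ c = c) (x y z : Fin n → K) :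
    cycMul n σ c (cycMul n σ c x y) z = cycMul n σ c x (cycMul n σ c y z) := by
  induction x using Pi.single_sum_induction with
  | zero => simp only [zero_cycMul]
  | add x x' hx hy => simp only [add_cycMul, hx, hy]
  | single i a =>
  induction y using Pi.single_sum_induction with
  | zero => simp only [zero_cycMul, cycMul_zero]
  | add x y hx hy => simp only [add_cycMul, cycMul_add, hx, hy]
  | single j b =>
  induction z using Pi.single_sum_induction with
  | zero => simp only [cycMul_zero]
  | add x y hx hy => simp only [cycMul_add, hx, hy]
  | single k e =>
    have hmod : σ ^ (((j : ℕ) + k) % n) = σ ^ (k : ℕ) * σ ^ (j : ℕ) := by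
      rw [← pow_add, add_comm (k : ℕ)]
      conv_rhs => rw [← Nat.mod_add_div ((j : ℕ) + k) n, pow_add, pow_mul, hσ, one_pow, mul_one]
    have h1 : ((i : ℕ) + j) / n + (((i : ℕ) + j) % n + k) / n = (i + j + k) / n := by
      conv_rhs => rw [← Nat.mod_add_div ((i : ℕ) + j) n, add_right_comm,
        Nat.add_mul_div_left _ _ hn]
      omega
    have h2 : ((j : ℕ) + k) / n + ((i : ℕ) + ((j : ℕ) + k) % n) / n = (i + j + k) / n := by
      conv_rhs => rw [add_assoc, ← Nat.mod_add_div ((j : ℕ) + k) n, ← add_assoc,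
        Nat.add_mul_div_left _ _ hn]
      omega
    simp only [cycMul_single hn]
    congr 1
    · simp [Nat.add_assoc]
    · simp only [map_mul, map_pow, RingEquiv.pow_apply_eq_self hc, hmod, RingAut.mul_apply]
      have h3 : c ^ (((i : ℕ) + j) / n) * c ^ ((((i : ℕ) + j) % n + k) / n) =
          c ^ (((j : ℕ) + k) / n) * c ^ (((i : ℕ) + ((j : ℕ) + k) % n) / n) := by
        rw [← pow_add, ← pow_add, h1, h2]
      linear_combination (σ ^ (k : ℕ)) ((σ ^ (j : ℕ)) a) * (σ ^ (k : ℕ)) b * e * h3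

theorem map_cycMul {ρ : K ≃+* K} (hρ : Commute ρ σ) (hc : ρ c = c) (x y : Fin n → K) :
    (fun r => ρ (cycMul n σ c x y r)) =
      cycMul n σ c (fun r => ρ (x r)) (fun r => ρ (y r)) := by
  funext r
  simp only [cycMul, map_sum]
  refine Finset.sum_congr rfl fun i _ => Finset.sum_congr rfl fun k _ => ?_
  have h : ρ ((σ ^ (k : ℕ)) (x i)) = (σ ^ (k : ℕ)) (ρ (x i)) :=
    DFunLike.congr_fun (hρ.pow_right (k : ℕ)).eq (x i)
  split_ifs
  · rw [map_mul, map_mul, map_pow, hc, h]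
  · exact map_zero ρ

end CycMul

/-- A cyclic algebra without zero divisors, presented by its multiplication `cycMul n σ c`, together
with an automorphism `τ` of the field commuting with `σ` and fixing `c`. -/
structure CyclicDivisionDatum (K : Type*) [Field K] where
  /-- The degree. -/
  n : ℕ
  /-- The automorphism defining the cyclic algebra. -/
  σ : K ≃+* K
  /-- The automorphism defining the twist. -/
  τ : K ≃+* K
  /-- The scalar `eⁿ`. -/
  c : K
  pos : 0 < n
  pow_eq_one : σ ^ n = 1
  commute : Commute σ τ
  map_σ : σ c = c
  map_τ : τ c = c
  mul_ne_zero : ∀ x y : Fin n → K, x ≠ 0 → y ≠ 0 → cycMul n σ c x y ≠ 0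

namespace CyclicDivisionDatum

variable {K : Type*} [Field K] (S : CyclicDivisionDatum K)

/-- The underlying type of the cyclic algebra. -/
def Alg : Type _ := Fin S.n → K

instance : AddCommGroup S.Alg := inferInstanceAs (AddCommGroup (Fin S.n → K))

instance : Module K S.Alg := inferInstanceAs (Module K (Fin S.n → K))

instance : FiniteDimensional K S.Alg := inferInstanceAs (FiniteDimensional K (Fin S.n → K))

noncomputable instance : Ring S.Alg where
  __ := (inferInstance : AddCommGroup S.Alg)
  mul x y := cycMul S.n S.σ S.c x y
  one := delta0 S.n 1
  left_distrib := cycMul_add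
  right_distrib := add_cycMul
  zero_mul := zero_cycMul
  mul_zero := cycMul_zero
  mul_assoc := cycMul_assoc S.pos S.pow_eq_one S.map_σ
  one_mul := delta0_one_cycMul S.pos
  mul_one x := (cycMul_delta0 S.pos 1 x).trans (one_smul K x)

theorem exists_mul_eq_one {x : S.Alg} (hx : x ≠ 0) : ∃ y, x * y = 1 := by
  let φ : S.Alg →ₗ[K] S.Alg :=
    { toFun := fun y => x * y
      map_add' := mul_add x
      map_smul' := fun a y => cycMul_smul a x y }
  have hφ : Function.Injective φ := by
    rw [← LinearMap.ker_eq_bot, LinearMap.ker_eq_bot']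
    intro y hy
    by_contra hy0
    exact S.mul_ne_zero x y hx hy0 hy
  exact LinearMap.injective_iff_surjective.1 hφ 1

instance : Nontrivial S.Alg :=
  have : Nonempty (Fin S.n) := ⟨⟨0, S.pos⟩⟩
  inferInstanceAs (Nontrivial (Fin S.n → K))

noncomputable instance : DivisionRing S.Alg :=
  DivisionRing.ofIsUnitOrEqZero fun x => or_iff_not_imp_right.2 fun hx => by
    obtain ⟨y, hy⟩ := S.exists_mul_eq_one hx
    obtain ⟨z, hz⟩ := S.exists_mul_eq_one (x := y) (by rintro rfl; simp at hy)
    have : x = z := by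
      rw [← mul_one x, ← hz, ← mul_assoc, hy, one_mul]
    exact ⟨⟨x, y, hy, this ▸ hz⟩, rfl⟩

theorem symm_commute : Commute S.τ.symm S.σ :=
  (Commute.inv_left (a := S.τ) S.commute.symm :)

theorem symm_map_c : S.τ.symm S.c = S.c := by
  rw [RingEquiv.symm_apply_eq, S.map_τ]

noncomputable instance : MulSemiringAction (Multiplicative ℕ) S.Alg where
  smul i x := fun r => (S.τ.symm ^ i.toAdd) (x r)
  one_smul _ := rfl
  mul_smul i j x := by
    funext r
    exact DFunLike.congr_fun (pow_add S.τ.symm i.toAdd j.toAdd) (x r)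
  smul_zero _ := funext fun _ => map_zero _
  smul_add _ _ _ := funext fun _ => map_add _ _ _
  smul_one i := by
    funext r
    change (S.τ.symm ^ i.toAdd) (delta0 S.n 1 r) = delta0 S.n 1 r
    unfold delta0
    split_ifs <;> simp
  smul_mul i x y := map_cycMul (S.symm_commute.pow_left _)
    (RingEquiv.pow_apply_eq_self S.symm_map_c _) x y

theorem φ_iterate_apply (i : ℕ) (x : S.Alg) (r : Fin S.n) :
    (SkewPolynomial.φ^[i] x) r = (S.τ.symm ^ i) (x r) := by
  rw [SkewPolynomial.φ_iterate_apply]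
  rfl

open SkewPolynomial

/-- Coefficient vectors as elements of the cyclic algebra. -/
def of : (Fin S.n → K) ≃+ S.Alg := AddEquiv.refl _

theorem of_apply (x : Fin S.n → K) (r : Fin S.n) : S.of x r = x r := rfl

theorem of_cycMul (x y : Fin S.n → K) : S.of (cycMul S.n S.σ S.c x y) = S.of x * S.of y := rfl

theorem φ_iterate_of (i : ℕ) (x : Fin S.n → K) :
    φ^[i] (S.of x) = S.of fun r => (S.τ.symm ^ i) (x r) :=
  funext fun r => S.φ_iterate_apply i (S.of x) r

/-- Finitely supported coefficient functions as skew polynomials over the cyclic algebra. -/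
noncomputable def toSkew : (ℕ →₀ (Fin S.n → K)) →+ SkewPolynomial S.Alg :=
  Finsupp.liftAddHom fun i => (monomial i).toAddMonoidHom.comp S.of.toAddMonoidHom

theorem toSkew_apply (f : ℕ →₀ (Fin S.n → K)) :
    S.toSkew f = f.sum fun i a => monomial i (S.of a) := rfl

theorem toSkew_single (i : ℕ) (a : Fin S.n → K) :
    S.toSkew (Finsupp.single i a) = monomial i (S.of a) := by
  rw [toSkew_apply, Finsupp.sum_single_index]
  rw [map_zero, map_zero]

theorem coeff_toSkew (f : ℕ →₀ (Fin S.n → K)) (i : ℕ) : (S.toSkew f).coeff i = S.of (f i) := by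
  induction f using Finsupp.induction_linear with
  | zero => rfl
  | add f g hf hg => rw [map_add, coeff_add, hf, hg, Finsupp.add_apply, map_add]
  | single j a =>
    rw [toSkew_single, coeff_monomial, Finsupp.single_apply]
    split_ifs <;> rfl

theorem toSkew_injective : Function.Injective S.toSkew := fun f g h =>
  Finsupp.ext fun i => S.of.injective (by rw [← coeff_toSkew, ← coeff_toSkew, h])

theorem toSkew_surjective : Function.Surjective S.toSkew := fun p => by
  induction p using SkewPolynomial.induction with
  | h0 => exact ⟨0, map_zero _⟩
  | ha i a q _ _ ih =>
    obtain ⟨f, rfl⟩ := ih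
    refine ⟨Finsupp.single i (S.of.symm a) + f, ?_⟩
    rw [map_add, toSkew_single, AddEquiv.apply_symm_apply]

theorem toSkew_skewMul (f g : ℕ →₀ (Fin S.n → K)) :
    S.toSkew (skewMul S.n S.σ S.τ S.c f g) = S.toSkew f * S.toSkew g := by
  simp only [skewMul, Finsupp.sum, map_sum, toSkew_single]
  simp only [toSkew_apply, Finsupp.sum, Finset.sum_mul_sum, monomial_mul_monomial, of_cycMul,
    φ_iterate_of]

theorem support_max_lt_iff (f : ℕ →₀ (Fin S.n → K)) (m : ℕ) :
    f.support.max < WithBot.some m ↔ S.toSkew f ∈ degLT S.Alg m := by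
  rw [mem_degLT, Finset.max, Finset.sup_lt_iff (WithBot.bot_lt_coe m)]
  constructor
  · intro h i hi
    rw [coeff_toSkew]
    by_contra hne
    have := h i (Finsupp.mem_support_iff.2 fun h0 => hne (by rw [h0, map_zero]))
    rw [WithBot.coe_lt_coe] at this
    omega
  · intro h i hi
    rw [WithBot.coe_lt_coe]
    by_contra hlt
    have := h i (by omega)
    rw [coeff_toSkew] at this
    exact Finsupp.mem_support_iff.1 hi (S.of.map_eq_zero_iff.1 this)

/-- The coefficient function of `tᵐ - d`. -/
noncomputable def binomial (m : ℕ) (d : K) : ℕ →₀ (Fin S.n → K) :=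
  Finsupp.single m (delta0 S.n (1 : K)) - Finsupp.single 0 (delta0 S.n d)

theorem toSkew_binomial (m : ℕ) (d : K) :
    S.toSkew (S.binomial m d) = monomial m 1 - monomial 0 (S.of (delta0 S.n d)) := by
  rw [binomial, map_sub, toSkew_single, toSkew_single]
  rfl

theorem toSkew_binomial_mem (m : ℕ) (d : K) :
    S.toSkew (S.binomial m d) ∈ degLT S.Alg (m + 1) := by
  rw [toSkew_binomial]
  exact sub_mem (monomial_mem_degLT (by omega) _) (monomial_mem_degLT (by omega) _)

theorem coeff_toSkew_binomial {m : ℕ} (hm : 0 < m) (d : K) :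
    (S.toSkew (S.binomial m d)).coeff m = 1 := by
  rw [toSkew_binomial, coeff_sub, coeff_monomial, coeff_monomial, if_pos rfl, if_neg (by omega),
    sub_zero]

theorem support_max_binomial {m : ℕ} (hm : 0 < m) (d : K) :
    (S.binomial m d).support.max = WithBot.some m := by
  refine le_antisymm ?_ ?_
  · have := (S.support_max_lt_iff _ _).2 (S.toSkew_binomial_mem m d)
    exact Finset.max_le fun i hi => WithBot.coe_le_coe.2
      (Nat.lt_succ_iff.1 (WithBot.coe_lt_coe.1 ((Finset.le_max hi).trans_lt this)))
  · refine Finset.le_max (Finsupp.mem_support_iff.2 fun h => ?_)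
    have := S.coeff_toSkew_binomial hm d
    rw [coeff_toSkew, h, map_zero] at this
    exact zero_ne_one this

theorem skewIrred_binomial_iff {m : ℕ} (hm : 0 < m) (d : K) :
    skewIrred S.n S.σ S.τ S.c (S.binomial m d) ↔
      ∀ g ∈ degLT S.Alg m, ∀ h ∈ degLT S.Alg m, S.toSkew (S.binomial m d) ≠ g * h := by
  simp only [skewIrred, support_max_binomial S hm, support_max_lt_iff]
  constructor
  · rintro H g hg h hh e
    obtain ⟨g, rfl⟩ := S.toSkew_surjective g
    obtain ⟨h, rfl⟩ := S.toSkew_surjective h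
    exact H ⟨g, h, hg, hh, S.toSkew_injective (by rw [e, toSkew_skewMul])⟩
  · rintro H ⟨g, h, hg, hh, e⟩
    exact H _ hg _ hh (by rw [e, toSkew_skewMul])

/-- The skew polynomial `∑ⱼ tʲ xⱼ`, where `xⱼ` is the `j`-th column of `x`. -/
noncomputable def ofColumns (m : ℕ) (x : Fin S.n → Fin m → K) : SkewPolynomial S.Alg :=
  ofFin S.Alg m fun j => φ^[(j : ℕ)] (S.of fun r => x r j)

theorem ofColumns_mem (m : ℕ) (x : Fin S.n → Fin m → K) : S.ofColumns m x ∈ degLT S.Alg m :=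
  ofFin_mem m _

theorem ofColumns_eq_zero_iff {m : ℕ} {x : Fin S.n → Fin m → K} :
    S.ofColumns m x = 0 ↔ x = 0 := by
  constructor
  · intro h
    funext r j
    have h1 := coeff_ofFin m (fun j : Fin m => φ^[(j : ℕ)] (S.of fun r => x r j)) j
    rw [← ofColumns, h] at h1
    have h2 : (0 : K) = (S.τ.symm ^ (j : ℕ)) (x r j) :=
      (congrFun h1 r).trans (S.φ_iterate_apply _ _ r)
    exact (map_eq_zero _).1 h2.symm
  · rintro rfl
    rw [ofColumns, ofFin_apply]
    refine Finset.sum_eq_zero fun j _ => ?_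
    have : (S.of fun r => (0 : Fin S.n → Fin m → K) r j) = 0 := rfl
    rw [this, iterate_map_zero, map_zero]

theorem symm_pow_apply_pow_apply (i : ℕ) (a : K) : (S.τ.symm ^ i) ((S.τ ^ i) a) = a :=
  DFunLike.congr_fun (show (S.τ⁻¹ ^ i * S.τ ^ i) = 1 by rw [inv_pow, inv_mul_cancel]) a

theorem exists_ofColumns_eq {m : ℕ} {p : SkewPolynomial S.Alg} (hp : p ∈ degLT S.Alg m) :
    ∃ x, S.ofColumns m x = p := by
  refine ⟨fun r j => (S.τ ^ (j : ℕ)) ((p.coeff j : S.Alg) r), ?_⟩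
  conv_rhs => rw [← ofFin_coeff hp]
  rw [ofColumns]
  congr 1
  funext j
  rw [φ_iterate_of]
  funext r
  exact S.symm_pow_apply_pow_apply _ _

theorem of_mul_of_delta0 (z : S.Alg) (d : K) : z * S.of (delta0 S.n d) = d • z :=
  cycMul_delta0 S.pos d z

theorem φ_iterate_eq_id {m : ℕ} (hτ : S.τ ^ m = 1) (z : S.Alg) : φ^[m] z = z := by
  funext r
  rw [φ_iterate_apply]
  exact DFunLike.congr_fun (show S.τ⁻¹ ^ m = 1 by rw [inv_pow, hτ, inv_one]) (z r)

/-- Reduction of `tᴺ z` modulo the left ideal generated by `tᵐ - d`. -/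
theorem monomial_sub_monomial_mod_mem {m N : ℕ} (hm : 0 < m) (hN : N < 2 * m) (d : K)
    (hτ : S.τ ^ m = 1) (z : S.Alg) :
    monomial N (φ^[N] z) - monomial (N % m) (φ^[N % m] (d ^ (N / m) • z)) ∈
      Ideal.span {S.toSkew (S.binomial m d)} := by
  by_cases h : N < m
  · rw [Nat.mod_eq_of_lt h, Nat.div_eq_of_lt h, pow_zero, one_smul, sub_self]
    exact zero_mem _
  · obtain ⟨s, rfl⟩ : ∃ s, N = s + m := ⟨N - m, by omega⟩
    have hs : s < m := by omega
    rw [Nat.add_mod_right, Nat.mod_eq_of_lt hs, Nat.add_div_right _ hm, Nat.div_eq_of_lt hs,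
      pow_one, Function.iterate_add_apply, S.φ_iterate_eq_id hτ]
    refine Ideal.mem_span_singleton'.2 ⟨monomial s (φ^[s] z), ?_⟩
    rw [toSkew_binomial, mul_sub, monomial_mul_monomial, monomial_mul_monomial, iterate_map_one,
      mul_one, add_zero, ← iterate_map_mul, of_mul_of_delta0]

theorem tenMul_column (m : ℕ) (d : K) (x y : Fin S.n → Fin m → K) (s : Fin m) :
    (S.of fun r => tenMul S.n m S.σ S.τ S.c d x y r s) =
      ∑ j : Fin m, ∑ l : Fin m, if ((j : ℕ) + l) % m = s then
        d ^ (((j : ℕ) + l) / m) •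
          (S.of (fun r => (S.τ ^ (l : ℕ)) (x r j)) * S.of fun r => y r l) else 0 := by
  funext r
  have apply_sum : ∀ (t : Finset (Fin m)) (u : Fin m → S.Alg), (∑ j ∈ t, u j) r = ∑ j ∈ t, u j r :=
    fun t u => Finset.sum_apply r t u
  rw [apply_sum]
  simp only [apply_sum, of_apply, tenMul]
  rw [Finset.sum_comm]
  refine Finset.sum_congr rfl fun j _ => ?_
  refine (Finset.sum_congr rfl fun i _ => Finset.sum_comm).trans (Finset.sum_comm.trans ?_)
  refine Finset.sum_congr rfl fun l _ => ?_
  split_ifs with h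
  · change _ = d ^ (((j : ℕ) + l) / m) * cycMul S.n S.σ S.c _ _ r
    simp only [cycMul, Finset.mul_sum, h, and_true]
    refine Finset.sum_congr rfl fun i _ => Finset.sum_congr rfl fun k _ => ?_
    simp only [of_apply]
    split_ifs <;> ring
  · simp only [h, and_false, if_false, Finset.sum_const_zero]
    rfl

theorem ofColumns_tenMul {m : ℕ} (hm : 0 < m) (d : K) (x y : Fin S.n → Fin m → K) :
    S.ofColumns m (tenMul S.n m S.σ S.τ S.c d x y) =
      ∑ j : Fin m, ∑ l : Fin m, monomial (((j : ℕ) + l) % m) (φ^[((j : ℕ) + l) % m]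
        (d ^ (((j : ℕ) + l) / m) •
          (S.of (fun r => (S.τ ^ (l : ℕ)) (x r j)) * S.of fun r => y r l))) := by
  rw [ofColumns, ofFin_apply]
  simp only [tenMul_column]
  have key : ∀ s : Fin m, ∀ z : Fin m → Fin m → S.Alg,
      monomial (s : ℕ) (φ^[(s : ℕ)] (∑ j, ∑ l, z j l)) =
        ∑ j, ∑ l, monomial (s : ℕ) (φ^[(s : ℕ)] (z j l)) := fun s z => by
    simp only [SkewPolynomial.φ_iterate_apply, Finset.smul_sum, map_sum]
  simp only [key]
  rw [Finset.sum_comm]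
  refine Finset.sum_congr rfl fun j _ => ?_
  rw [Finset.sum_comm]
  refine Finset.sum_congr rfl fun l _ => ?_
  rw [Finset.sum_eq_single ⟨((j : ℕ) + l) % m, Nat.mod_lt _ hm⟩]
  · rw [if_pos rfl]
  · intro s _ hs
    rw [if_neg fun h => hs (Fin.ext h.symm), iterate_map_zero, map_zero]
  · simp

theorem ofColumns_mul_ofColumns (m : ℕ) (x y : Fin S.n → Fin m → K) :
    S.ofColumns m x * S.ofColumns m y =
      ∑ j : Fin m, ∑ l : Fin m, monomial ((j : ℕ) + l) (φ^[(j : ℕ) + l]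
        (S.of (fun r => (S.τ ^ (l : ℕ)) (x r j)) * S.of fun r => y r l)) := by
  rw [ofColumns, ofColumns, ofFin_apply, ofFin_apply, Finset.sum_mul_sum]
  refine Finset.sum_congr rfl fun j _ => Finset.sum_congr rfl fun l _ => ?_
  rw [monomial_mul_monomial, iterate_map_mul, ← Function.iterate_add_apply,
    Function.iterate_add_apply _ _ _ (S.of fun r => (S.τ ^ (l : ℕ)) (x r j)),
    S.φ_iterate_of l]
  simp only [symm_pow_apply_pow_apply]

/-- The product of the tensor product algebra is the product of skew polynomials modulo the left
ideal generated by `tᵐ - d`. -/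
theorem ofColumns_mul_sub_mem {m : ℕ} (hm : 0 < m) (d : K) (hτ : S.τ ^ m = 1)
    (x y : Fin S.n → Fin m → K) :
    S.ofColumns m x * S.ofColumns m y - S.ofColumns m (tenMul S.n m S.σ S.τ S.c d x y) ∈
      Ideal.span {S.toSkew (S.binomial m d)} := by
  rw [ofColumns_tenMul S hm, ofColumns_mul_ofColumns, ← Finset.sum_sub_distrib]
  refine sum_mem fun j _ => ?_
  rw [← Finset.sum_sub_distrib]
  exact sum_mem fun l _ => S.monomial_sub_monomial_mod_mem hm (by omega) d hτ _

theorem tenMul_eq_zero_iff {m : ℕ} (hm : 0 < m) (d : K) (hτ : S.τ ^ m = 1)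
    (x y : Fin S.n → Fin m → K) :
    tenMul S.n m S.σ S.τ S.c d x y = 0 ↔
      S.ofColumns m x * S.ofColumns m y ∈ Ideal.span {S.toSkew (S.binomial m d)} := by
  have h := S.ofColumns_mul_sub_mem hm d hτ x y
  constructor
  · intro h0
    rwa [S.ofColumns_eq_zero_iff.2 h0, sub_zero] at h
  · intro h0
    have h1 := sub_mem h0 h
    rw [sub_sub_cancel] at h1
    obtain ⟨q, hq⟩ := Ideal.mem_span_singleton'.1 h1
    have hq0 : q = 0 := eq_zero_of_mul_mem_degLT (S.toSkew_binomial_mem m d)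
      (by rw [S.coeff_toSkew_binomial hm]; exact one_ne_zero) (hq ▸ S.ofColumns_mem m _)
    rw [hq0, zero_mul] at hq
    exact S.ofColumns_eq_zero_iff.1 hq.symm

theorem forall_tenMul_ne_zero_iff {m : ℕ} (hm : 0 < m) (d : K) (hτ : S.τ ^ m = 1) :
    (∀ x y : Fin S.n → Fin m → K, x ≠ 0 → y ≠ 0 → tenMul S.n m S.σ S.τ S.c d x y ≠ 0) ↔
      skewIrred S.n S.σ S.τ S.c (S.binomial m d) := by
  rw [S.skewIrred_binomial_iff hm, ← forall_mul_notMem_span_iff (S.toSkew_binomial_mem m d)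
    (by rw [S.coeff_toSkew_binomial hm]; exact one_ne_zero)]
  constructor
  · intro H g hg h hh hg0 hh0 hgh
    obtain ⟨x, rfl⟩ := S.exists_ofColumns_eq hg
    obtain ⟨y, rfl⟩ := S.exists_ofColumns_eq hh
    exact H x y (mt S.ofColumns_eq_zero_iff.2 hg0) (mt S.ofColumns_eq_zero_iff.2 hh0)
      ((S.tenMul_eq_zero_iff hm d hτ x y).2 hgh)
  · intro H x y hx hy h
    exact H _ (S.ofColumns_mem m x) _ (S.ofColumns_mem m y) (mt S.ofColumns_eq_zero_iff.1 hx)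
      (mt S.ofColumns_eq_zero_iff.1 hy) ((S.tenMul_eq_zero_iff hm d hτ x y).1 h)

end CyclicDivisionDatum

/-- Suppose `D = (K/F,σ,c)` is a division algebra. Then the tensor product
algebra `A = (L/F₀,σ,c) ⊗_{F₀} (F/F₀,τ,d)` is a division algebra iff `f(t) = t^m − d` is
irreducible in `D[t;τ̃⁻¹]`. -/
theorem tensor_division_iff_irreducible {K : Type*} [Field K] (n m : ℕ)
    (hn : 0 < n) (hm : 0 < m)
    (σ τ : K ≃+* K) (hσord : orderOf σ = n) (hτord : orderOf τ = m)
    (hcomm : σ * τ = τ * σ)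
    (hindep : ∀ i j : ℕ, i < n → j < m → σ ^ i * τ ^ j = 1 → i = 0 ∧ j = 0)
    (c : K) (hc0 : c ≠ 0) (hcσ : σ c = c) (hcτ : τ c = c)
    (d : K) (hd0 : d ≠ 0) (hdσ : σ d = d)
    (hD : ∀ x y : Fin n → K, x ≠ 0 → y ≠ 0 → cycMul n σ c x y ≠ 0) :
    (∀ x y : Fin n → Fin m → K, x ≠ 0 → y ≠ 0 → tenMul n m σ τ c d x y ≠ 0) ↔
      skewIrred n σ τ c
        (Finsupp.single m (delta0 n (1 : K)) - Finsupp.single 0 (delta0 n d)) := by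
  exact CyclicDivisionDatum.forall_tenMul_ne_zero_iff
    { n := n, σ := σ, τ := τ, c := c, pos := hn, pow_eq_one := hσord ▸ pow_orderOf_eq_one σ,
      commute := hcomm, map_σ := hcσ, map_τ := hcτ, mul_ne_zero := hD } hm d
    (hτord ▸ pow_orderOf_eq_one τ)
end

section
/- Suppose d ∈ F ∖ F₀ (so (F/F₀,τ,d) is a nonassociative cyclic algebra of degree m), D = (K/F,σ,c) is a division algebra, m is prime, and, in case m ≠ 2 and m ≠ 3, F₀ contains a primitive m-th root of unity. Then the tensor product algebra A = (L/F₀,σ,c) ⊗_{F₀} (F/F₀,τ,d) is a division algebra if and only if d ≠ z·τ̃(z)·τ̃²(z)⋯τ̃^{m−1}(z) for all z ∈ D. -/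
section TwistedMonomials

variable {R : Type*} [Ring R] {n : ℕ}

/-- The monomial `eᵏ a` in the algebra with basis `1, e, …, eⁿ⁻¹` and `eⁿ = c`. -/
def twistMono (n : ℕ) (c : R) (k : ℕ) (a : R) : Fin n → R :=
  fun r => if k % n = (r : ℕ) then c ^ (k / n) * a else 0

/-- The product determined by `(eⁱ a)(eᵏ b) = eⁱ⁺ᵏ σᵏ(a) b`. -/
def twistMul (n : ℕ) (σ : R ≃+* R) (c : R) (x y : Fin n → R) : Fin n → R :=
  ∑ i : Fin n, ∑ k : Fin n, twistMono n c (i + k) ((σ ^ (k : ℕ)) (x i) * y k)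

@[simp] lemma twistMono_zero (c : R) (k : ℕ) : twistMono n c k 0 = 0 := by
  ext r; simp [twistMono]

lemma twistMono_add (c : R) (k : ℕ) (a b : R) :
    twistMono n c k (a + b) = twistMono n c k a + twistMono n c k b := by
  ext r; by_cases h : k % n = (r : ℕ) <;> simp [twistMono, h, mul_add]

lemma twistMono_add_left (c : R) (k : ℕ) (a : R) :
    twistMono n c (k + n) a = twistMono n c k (c * a) := by
  ext r
  have := r.pos
  simp only [twistMono, Nat.add_mod_right, Nat.add_div_right _ this, pow_succ, mul_assoc]

lemma twistMono_mod_add (c : R) (k j : ℕ) (a : R) :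
    twistMono n c (k % n + j) (c ^ (k / n) * a) = twistMono n c (k + j) a := by
  ext r
  have hn := r.pos
  have h : (k + j) / n = (k % n + j) / n + k / n := by
    conv_lhs => rw [← Nat.mod_add_div k n, add_right_comm, Nat.add_mul_div_left _ _ hn]
  simp only [twistMono, Nat.mod_add_mod, h, pow_add, mul_assoc]

lemma sum_twistMono (c : R) (y : Fin n → R) : ∑ l : Fin n, twistMono n c l (y l) = y := by
  ext r
  rw [Finset.sum_apply, Finset.sum_eq_single r]
  · simp [twistMono, Nat.mod_eq_of_lt r.isLt, Nat.div_eq_of_lt r.isLt]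
  · intro l _ hl
    simp [twistMono, Nat.mod_eq_of_lt l.isLt, Fin.val_inj, hl]
  · simp

lemma twistMono_induction (c : R) {P : (Fin n → R) → Prop} (x : Fin n → R) (zero : P 0)
    (add : ∀ x y, P x → P y → P (x + y)) (mono : ∀ k a, P (twistMono n c k a)) : P x := by
  rw [← sum_twistMono c x]
  exact Finset.sum_induction _ P add zero fun l _ => mono l _

lemma sum_apply_twistMono {X : Type*} [AddCommMonoid X] (hn : 0 < n) (c : R) (k : ℕ) (a : R)
    (g : ℕ → R → X) (hg : ∀ l, g l 0 = 0) :
    ∑ l : Fin n, g l (twistMono n c k a l) = g (k % n) (c ^ (k / n) * a) := by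
  rw [Finset.sum_eq_single ⟨k % n, Nat.mod_lt _ hn⟩]
  · simp [twistMono]
  · intro l _ hl
    have : k % n ≠ (l : ℕ) := fun h => hl (Fin.ext h.symm)
    simp [twistMono, this, hg]
  · simp

lemma add_twistMul (σ : R ≃+* R) (c : R) (x x' y : Fin n → R) :
    twistMul n σ c (x + x') y = twistMul n σ c x y + twistMul n σ c x' y := by
  simp [twistMul, add_mul, twistMono_add, Finset.sum_add_distrib]

lemma twistMul_add (σ : R ≃+* R) (c : R) (x y y' : Fin n → R) :
    twistMul n σ c x (y + y') = twistMul n σ c x y + twistMul n σ c x y' := by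
  simp [twistMul, mul_add, twistMono_add, Finset.sum_add_distrib]

@[simp] lemma zero_twistMul (σ : R ≃+* R) (c : R) (y : Fin n → R) :
    twistMul n σ c 0 y = 0 := by
  simp [twistMul]

@[simp] lemma twistMul_zero (σ : R ≃+* R) (c : R) (x : Fin n → R) :
    twistMul n σ c x 0 = 0 := by
  simp [twistMul]

lemma pow_mod_of_pow_eq_one {G : Type*} [Monoid G] {g : G} (hg : g ^ n = 1) (k : ℕ) :
    g ^ (k % n) = g ^ k := by
  conv_rhs => rw [← Nat.mod_add_div k n, pow_add, pow_mul, hg, one_pow, mul_one]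

lemma ringEquiv_pow_apply_eq {σ : R ≃+* R} {c : R} (h : σ c = c) (k : ℕ) :
    (σ ^ k) c = c := by
  induction k with
  | zero => rfl
  | succ k ih => rw [pow_succ, RingAut.mul_apply, h, ih]

lemma twistMul_twistMono (hn : 0 < n) {σ : R ≃+* R} (hσ : σ ^ n = 1) {c : R}
    (hc : ∀ x, Commute c x) (hσc : σ c = c) (i k : ℕ) (a b : R) :
    twistMul n σ c (twistMono n c i a) (twistMono n c k b) =
      twistMono n c (i + k) ((σ ^ k) a * b) := by
  unfold twistMul
  rw [sum_apply_twistMono hn c i a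
    (fun i' a' => ∑ l : Fin n, twistMono n c (i' + l) ((σ ^ (l : ℕ)) a' * twistMono n c k b l))
    (by simp),
    sum_apply_twistMono hn c k b
    (fun l b' => twistMono n c (i % n + l) ((σ ^ l) (c ^ (i / n) * a) * b')) (by simp)]
  rw [pow_mod_of_pow_eq_one hσ, map_mul, map_pow, ringEquiv_pow_apply_eq hσc, mul_assoc,
    twistMono_mod_add, ← mul_assoc, (((hc _).pow_left _).symm).eq, mul_assoc, add_comm i,
    twistMono_mod_add, add_comm]

lemma twistMul_assoc (hn : 0 < n) {σ : R ≃+* R} (hσ : σ ^ n = 1) {c : R}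
    (hc : ∀ x, Commute c x) (hσc : σ c = c) (x y z : Fin n → R) :
    twistMul n σ c (twistMul n σ c x y) z = twistMul n σ c x (twistMul n σ c y z) := by
  induction x using twistMono_induction c with
  | zero => simp
  | add x x' hx hx' => simp only [add_twistMul, hx, hx']
  | mono i a =>
  induction y using twistMono_induction c with
  | zero => simp
  | add x x' hx hx' => simp only [add_twistMul, twistMul_add, hx, hx']
  | mono k b =>
  induction z using twistMono_induction c with
  | zero => simp
  | add x x' hx hx' => simp only [twistMul_add, hx, hx']
  | mono l e =>
  simp only [twistMul_twistMono hn hσ hc hσc, map_mul, mul_assoc, add_assoc]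
  rw [add_comm k l, pow_add, RingAut.mul_apply]

lemma twistMono_zero_twistMul (σ : R ≃+* R) {c : R} (a : R) (y : Fin n → R) (hn : 0 < n) :
    twistMul n σ c (twistMono n c 0 a) y = fun k : Fin n => (σ ^ (k : ℕ)) a * y k := by
  unfold twistMul
  rw [sum_apply_twistMono hn c 0 a
    (fun i' a' => ∑ l : Fin n, twistMono n c (i' + (l : ℕ)) ((σ ^ (l : ℕ)) a' * y l)) (by simp)]
  simpa using sum_twistMono c fun k : Fin n => (σ ^ (k : ℕ)) a * y k

lemma twistMul_twistMono_zero (hn : 0 < n) {σ : R ≃+* R} {c : R}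
    (x : Fin n → R) (b : R) :
    twistMul n σ c x (twistMono n c 0 b) = fun k => x k * b := by
  unfold twistMul
  have (i : Fin n) := sum_apply_twistMono hn c 0 b
    (fun l b' => twistMono n c (i + l) ((σ ^ l) (x i) * b')) (by simp)
  simp only [this]
  simpa using sum_twistMono c fun k : Fin n => x k * b

end TwistedMonomials

section StableSubmodules

open Module

variable {D V : Type*} [DivisionRing D] [AddCommGroup V] [Module D V] {θ : D →+* D}

lemma exists_stable_submodule_of_sum_eq_zero (T : V →ₛₗ[θ] V) {y : V} (hy : y ≠ 0) {m : ℕ}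
    (x : ℕ → D) (hx : ∃ j < m, x j ≠ 0)
    (h : ∑ j ∈ Finset.range m, T^[j] (x j • y) = 0) :
    ∃ N : Submodule D V, N ≠ ⊥ ∧ (∀ v ∈ N, T v ∈ N) ∧ finrank D N < m := by
  classical
  have hit : ∀ (j : ℕ) (a : D) (v : V), T^[j] (a • v) = θ^[j] a • T^[j] v := by
    intro j
    induction j with
    | zero => intros; rfl
    | succ j ih => intro a v; simp only [Function.iterate_succ_apply, map_smulₛₗ, ih]
  induction m with
  | zero => obtain ⟨j, hj, _⟩ := hx; omega
  | succ k ih =>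
  by_cases hk : x k = 0
  · obtain ⟨j, hj, hxj⟩ := hx
    have hjk : j ≠ k := by rintro rfl; exact hxj hk
    obtain ⟨N, h1, h2, h3⟩ := ih ⟨j, by omega, hxj⟩ (by
      simpa [Finset.sum_range_succ, hk, hit k, Function.iterate_fixed (map_zero θ)] using h)
    exact ⟨N, h1, h2, by omega⟩
  · set N : Submodule D V := Submodule.span D ((Finset.range k).image fun j => T^[j] y) with hN
    have hmem : ∀ j < k, T^[j] y ∈ N := fun j hj => Submodule.subset_span (by
      simp only [Finset.coe_image, Set.mem_image, Finset.coe_range, Set.mem_Iio]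
      exact ⟨j, hj, rfl⟩)
    have hθk : θ^[k] (x k) ≠ 0 := fun h0 => hk
      (Function.Injective.iterate θ.injective k (by rw [h0, Function.iterate_fixed (map_zero θ)]))
    have hkN : T^[k] y ∈ N := by
      rw [Finset.sum_range_succ, hit k] at h
      rw [← N.smul_mem_iff hθk, eq_neg_of_add_eq_zero_right h]
      refine N.neg_mem (N.sum_mem fun j hj => ?_)
      rw [hit]
      exact N.smul_mem _ (hmem j (Finset.mem_range.1 hj))
    refine ⟨N, ?_, ?_, ?_⟩
    · intro hbot
      rcases Nat.eq_zero_or_pos k with rfl | hpos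
      · exact hy ((Submodule.mem_bot D).1 (hbot ▸ hkN))
      · exact hy ((Submodule.mem_bot D).1 (hbot ▸ hmem 0 hpos))
    · suffices N ≤ N.comap T from this
      rw [hN, Submodule.span_le, ← hN]
      intro v hv
      simp only [Finset.coe_image, Set.mem_image, Finset.coe_range, Set.mem_Iio] at hv
      obtain ⟨j, hj, rfl⟩ := hv
      change T (T^[j] y) ∈ N
      rw [← Function.iterate_succ_apply' (f := T)]
      rcases Nat.lt_or_ge (j + 1) k with h' | h'
      · exact hmem _ h'
      · obtain rfl : j + 1 = k := by omega
        exact hkN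
    · calc finrank D N ≤ ((Finset.range k).image fun j => T^[j] y).card :=
            finrank_span_finset_le_card _
        _ ≤ k := Finset.card_image_le.trans (by simp)
        _ < k + 1 := k.lt_succ_self

lemma exists_eigenvector_of_finrank_eq_one (T : V →ₛₗ[θ] V) {N : Submodule D V}
    (hT : ∀ v ∈ N, T v ∈ N) (h1 : finrank D N = 1) : ∃ y ≠ 0, ∃ a : D, T y = a • y := by
  obtain ⟨⟨y, hyN⟩, hy0, hy⟩ := finrank_eq_one_iff'.1 h1
  obtain ⟨a, ha⟩ := hy ⟨T y, hT y hyN⟩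
  exact ⟨y, fun h => hy0 (Subtype.ext h), a, (congrArg Subtype.val ha).symm⟩

lemma exists_eigenvector_of_twist [FiniteDimensional D V] (hp : (finrank D V).Prime)
    (T : V →ₛₗ[θ] V) (U : V ≃ₗ[D] V) {b : D} (hTU : ∀ v, T (U v) = b • U (T v))
    (hfull : ∀ N : Submodule D V, N ≠ ⊥ → (∀ v ∈ N, T v ∈ N) → (∀ v ∈ N, U v ∈ N) → N = ⊤)
    (hex : ∃ N : Submodule D V, N ≠ ⊥ ∧ (∀ v ∈ N, T v ∈ N) ∧ finrank D N < finrank D V) :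
    ∃ y ≠ 0, ∃ a : D, T y = a • y := by
  classical
  have hex' : ∃ k, ∃ N : Submodule D V, N ≠ ⊥ ∧ (∀ v ∈ N, T v ∈ N) ∧ finrank D N = k :=
    let ⟨N, h1, h2, _⟩ := hex; ⟨_, N, h1, h2, rfl⟩
  obtain ⟨N, hN0, hNT, hNk⟩ := Nat.find_spec hex'
  set k := Nat.find hex'
  have hmin : ∀ W : Submodule D V, W ≠ ⊥ → (∀ v ∈ W, T v ∈ W) → k ≤ finrank D W :=
    fun W h1 h2 => Nat.find_min' hex' ⟨W, h1, h2, rfl⟩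
  have hklt : k < finrank D V := by
    obtain ⟨W, h1, h2, h3⟩ := hex
    exact (hmin W h1 h2).trans_lt h3
  let C : ℕ → Submodule D V := fun j => N.map (U ^ j : V ≃ₗ[D] V).toLinearMap
  have hCT : ∀ j, ∀ v ∈ C j, T v ∈ C j := by
    intro j
    induction j with
    | zero =>
      rintro _ ⟨v, hv, rfl⟩
      exact ⟨T v, hNT v hv, rfl⟩
    | succ j ih =>
      rintro _ ⟨v, hv, rfl⟩
      obtain ⟨w, hw, hw'⟩ := ih _ ⟨v, hv, rfl⟩
      refine ⟨b • w, N.smul_mem b hw, ?_⟩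
      simp only [LinearEquiv.coe_coe, pow_succ', LinearEquiv.mul_apply, map_smul] at hw' ⊢
      rw [hTU, hw']
  have hCk : ∀ j, finrank D (C j) = k := fun j => by
    rw [← hNk]; exact LinearEquiv.finrank_map_eq _ _
  obtain ⟨W, hWT, hWk, hWmax⟩ : ∃ W : Submodule D V, (∀ v ∈ W, T v ∈ W) ∧ k ∣ finrank D W ∧
      ∀ W' : Submodule D V, (∀ v ∈ W', T v ∈ W') → k ∣ finrank D W' →
        finrank D W' ≤ finrank D W := by
    let P : ℕ → Prop := fun r => ∃ W : Submodule D V, (∀ v ∈ W, T v ∈ W) ∧ k ∣ finrank D W ∧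
      finrank D W = r
    obtain ⟨W, h1, h2, h3⟩ := Nat.findGreatest_spec (P := P) (n := finrank D V)
      (hNk ▸ N.finrank_le) ⟨N, hNT, hNk ▸ dvd_rfl, hNk⟩
    refine ⟨W, h1, h2, fun W' h1' h2' => ?_⟩
    rw [h3]
    exact Nat.le_findGreatest W'.finrank_le ⟨W', h1', h2', rfl⟩
  have hCW : ∀ j, C j ≤ W := by
    intro j
    by_cases hbot : W ⊓ C j = ⊥
    · have h1 := Submodule.finrank_sup_add_finrank_inf_eq W (C j)
      rw [hbot, finrank_bot, add_zero, hCk] at h1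
      have h2 := hWmax (W ⊔ C j) (by
        intro v hv
        obtain ⟨p, hp, q, hq, rfl⟩ := Submodule.mem_sup.1 hv
        rw [map_add]
        exact Submodule.add_mem_sup (hWT p hp) (hCT j q hq)) (h1 ▸ hWk.add dvd_rfl)
      have h3 : k ≠ 0 := by
        rw [← hNk]; exact fun h => hN0 (Submodule.finrank_eq_zero.1 h)
      omega
    · have h1 := hmin _ hbot fun v hv => ⟨hWT v hv.1, hCT j v hv.2⟩
      have h2 : W ⊓ C j = C j := Submodule.eq_of_le_of_finrank_le inf_le_right (by rwa [hCk])
      exact inf_eq_right.1 h2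
  have htop : ⨆ j, C j = ⊤ := by
    apply hfull
    · intro h
      refine hN0 (le_bot_iff.1 (h ▸ (le_trans ?_ (le_iSup C 0))))
      intro v hv
      exact ⟨v, hv, rfl⟩
    · suffices ⨆ j, C j ≤ (⨆ j, C j).comap T from this
      exact iSup_le fun j v hv => le_iSup C j (hCT j v hv)
    · suffices ⨆ j, C j ≤ (⨆ j, C j).comap U.toLinearMap from this
      refine iSup_le fun j => ?_
      rintro _ ⟨v, hv, rfl⟩
      refine le_iSup C (j + 1) ⟨v, hv, ?_⟩
      simp [pow_succ']
  have hWtop : W = ⊤ := top_le_iff.1 (htop ▸ iSup_le hCW)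
  rw [hWtop, finrank_top] at hWk
  rcases (Nat.dvd_prime hp).1 hWk with h | h
  · exact exists_eigenvector_of_finrank_eq_one T hNT (hNk.trans h)
  · omega

end StableSubmodules

section NormCondition

open Module

variable {D : Type*} [DivisionRing D] {m : ℕ}

/-- The twisted norm `z * t z * ⋯ * t ^ (j - 1) z`. -/
def twistNorm (t : D ≃+* D) (z : D) : ℕ → D
  | 0 => 1
  | j + 1 => twistNorm t z j * (t ^ j) z

/-- The passage from right coefficients to left coefficients: `tʳ a = t⁻ʳ(a) tʳ`. -/
def untwist (t : D ≃+* D) (m : ℕ) : (Fin m → D) ≃+ (Fin m → D) where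
  toFun y := fun r => (t ^ (r : ℕ)).symm (y r)
  invFun y := fun r => (t ^ (r : ℕ)) (y r)
  left_inv y := funext fun r => RingEquiv.apply_symm_apply (t ^ (r : ℕ)) (y r)
  right_inv y := funext fun r => RingEquiv.symm_apply_apply (t ^ (r : ℕ)) (y r)
  map_add' x y := by ext; simp

/-- Left multiplication by a scalar in right coefficients. -/
def leftAct (t : D ≃+* D) (a : D) : (Fin m → D) →+ (Fin m → D) where
  toFun y := fun r => (t ^ (r : ℕ)) a * y r
  map_zero' := by ext; simp
  map_add' x y := by ext; simp [mul_add]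

/-- Left multiplication by the generator in right coefficients. -/
def shift (m : ℕ) (d : D) : (Fin m → D) →+ (Fin m → D) where
  toFun y := ∑ l : Fin m, twistMono m d (l + 1) (y l)
  map_zero' := by simp
  map_add' x y := by simp [twistMono_add, Finset.sum_add_distrib]

lemma smul_untwist (t : D ≃+* D) (a : D) (y : Fin m → D) :
    a • untwist t m y = untwist t m (leftAct t a y) := by
  ext r
  change a * (t ^ (r : ℕ)).symm (y r) = (t ^ (r : ℕ)).symm ((t ^ (r : ℕ)) a * y r)
  rw [map_mul, RingEquiv.symm_apply_apply]

lemma shift_twistMono (hm : 0 < m) (d : D) (k : ℕ) (a : D) :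
    shift m d (twistMono m d k a) = twistMono m d (k + 1) a := by
  change ∑ l : Fin m, twistMono m d (l + 1) (twistMono m d k a l) = _
  rw [sum_apply_twistMono hm d k a (fun l a => twistMono m d (l + 1) a) (by simp),
    twistMono_mod_add]

lemma shift_iterate_twistMono (hm : 0 < m) (d : D) (j k : ℕ) (a : D) :
    (shift m d)^[j] (twistMono m d k a) = twistMono m d (k + j) a := by
  induction j with
  | zero => rfl
  | succ j ih => rw [Function.iterate_succ_apply', ih, shift_twistMono hm, add_assoc]

lemma leftAct_twistMono {t : D ≃+* D} (ht : t ^ m = 1) {d : D} (hd : ∀ x, Commute d x)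
    (k : ℕ) (a b : D) :
    leftAct t b (twistMono m d k a) = twistMono m d k ((t ^ k) b * a) := by
  ext r
  by_cases h : k % m = (r : ℕ)
  · simp only [leftAct, twistMono, AddMonoidHom.coe_mk, ZeroHom.coe_mk, h, if_true]
    rw [← h, pow_mod_of_pow_eq_one ht, ← mul_assoc, ← mul_assoc, ((hd _).pow_left _).eq]
  · simp [leftAct, twistMono, h]

lemma shift_leftAct (hm : 0 < m) {t : D ≃+* D} (ht : t ^ m = 1) {d : D}
    (hd : ∀ x, Commute d x) (b : D) (y : Fin m → D) :
    shift m d (leftAct t (t b) y) = leftAct t b (shift m d y) := by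
  induction y using twistMono_induction d with
  | zero => simp
  | add x y hx hy => simp only [map_add, hx, hy]
  | mono k a =>
    rw [leftAct_twistMono ht hd, shift_twistMono hm, shift_twistMono hm,
      leftAct_twistMono ht hd, pow_succ, RingAut.mul_apply]

/-- Left multiplication by the generator as a semilinear map in left coefficients. -/
def shiftSL (hm : 0 < m) {t : D ≃+* D} (ht : t ^ m = 1) {d : D} (hd : ∀ x, Commute d x) :
    (Fin m → D) →ₛₗ[(t.symm : D →+* D)] (Fin m → D) where
  toFun y := untwist t m (shift m d ((untwist t m).symm y))
  map_add' x y := by simp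
  map_smul' a y := by
    obtain ⟨y, rfl⟩ := (untwist t m).surjective y
    rw [smul_untwist, AddEquiv.symm_apply_apply, AddEquiv.symm_apply_apply, smul_untwist,
      ← shift_leftAct hm ht hd]
    simp

lemma shiftSL_untwist (hm : 0 < m) {t : D ≃+* D} (ht : t ^ m = 1) {d : D}
    (hd : ∀ x, Commute d x) (y : Fin m → D) :
    shiftSL hm ht hd (untwist t m y) = untwist t m (shift m d y) := by
  change untwist t m (shift m d ((untwist t m).symm (untwist t m y))) = _
  rw [AddEquiv.symm_apply_apply]

lemma shiftSL_iterate_untwist (hm : 0 < m) {t : D ≃+* D} (ht : t ^ m = 1) {d : D}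
    (hd : ∀ x, Commute d x) (j : ℕ) (y : Fin m → D) :
    (shiftSL hm ht hd)^[j] (untwist t m y) = untwist t m ((shift m d)^[j] y) := by
  induction j with
  | zero => rfl
  | succ j ih => rw [Function.iterate_succ_apply', ih, shiftSL_untwist,
      ← Function.iterate_succ_apply' (f := shift m d)]

lemma twistMul_eq_sum_shift (hm : 0 < m) (t : D ≃+* D) (d : D) (x y : Fin m → D) :
    twistMul m t d x y = ∑ j : Fin m, (shift m d)^[(j : ℕ)] (leftAct t (x j) y) := by
  unfold twistMul
  refine Finset.sum_congr rfl fun j _ => ?_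
  have h (z : Fin m → D) :
      (shift m d)^[(j : ℕ)] z = ∑ l : Fin m, twistMono m d (j + l) (z l) := by
    induction z using twistMono_induction d with
    | zero => simp [iterate_map_zero]
    | add x y hx hy => simp only [iterate_map_add, hx, hy, Pi.add_apply, twistMono_add,
        Finset.sum_add_distrib]
    | mono k a =>
      rw [sum_apply_twistMono hm d k a (fun l a => twistMono m d (j + l) a) (by simp),
        shift_iterate_twistMono hm, add_comm (j : ℕ), twistMono_mod_add]
  rw [h]
  rfl

lemma untwist_twistMul (hm : 0 < m) {t : D ≃+* D} (ht : t ^ m = 1) {d : D}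
    (hd : ∀ x, Commute d x) (x y : Fin m → D) :
    untwist t m (twistMul m t d x y) =
      ∑ j : Fin m, (shiftSL hm ht hd)^[(j : ℕ)] (x j • untwist t m y) := by
  simp only [twistMul_eq_sum_shift hm, map_sum, smul_untwist, shiftSL_iterate_untwist]

/-- Every vector is a combination of the iterates of the first basis vector. -/
lemma eq_top_of_mono_mem (hm : 0 < m) {t : D ≃+* D} (ht : t ^ m = 1) {d : D} (hd0 : d ≠ 0)
    (hd : ∀ x, Commute d x) {N : Submodule D (Fin m → D)}
    (hN : ∀ v ∈ N, shiftSL hm ht hd v ∈ N) {k : ℕ} {a : D} (ha : a ≠ 0)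
    (h : untwist t m (twistMono m d k a) ∈ N) : N = ⊤ := by
  have hscal : ∀ k (a b : D), a ≠ 0 → untwist t m (twistMono m d k a) ∈ N →
      untwist t m (twistMono m d k b) ∈ N := by
    intro k a b ha h
    have := N.smul_mem ((t ^ k).symm (b * a⁻¹)) h
    rwa [smul_untwist, leftAct_twistMono ht hd, RingEquiv.apply_symm_apply, mul_assoc,
      inv_mul_cancel₀ ha, mul_one] at this
  have hup : ∀ j, ∀ b, untwist t m (twistMono m d (k + j) b) ∈ N := by
    intro j
    induction j with
    | zero => exact fun b => hscal k a b ha h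
    | succ j ih =>
      intro b
      have := hN _ (ih b)
      rwa [shiftSL_untwist, shift_twistMono hm, add_assoc] at this
  have hmul : ∀ q l : ℕ, ∀ b, untwist t m (twistMono m d (l + m * q) b) ∈ N →
      untwist t m (twistMono m d l (d ^ q * b)) ∈ N := by
    intro q l b h
    have := twistMono_mod_add (n := m) d (l + m * q) 0 b
    have h2 := twistMono_mod_add (n := m) d l 0 (d ^ q * b)
    simp only [add_zero, Nat.add_mul_mod_self_left, Nat.add_mul_div_left _ _ hm, pow_add,
      mul_assoc] at this h2
    rwa [← h2, this]
  refine top_le_iff.1 fun v _ => ?_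
  obtain ⟨y, rfl⟩ := (untwist t m).surjective v
  rw [← sum_twistMono d y, map_sum]
  refine N.sum_mem fun l _ => ?_
  have h1 : k ≤ l + m * k := (Nat.le_mul_of_pos_left k hm).trans (Nat.le_add_left _ _)
  have h2 := hmul k l 1 (by
    have := hup (l + m * k - k) 1
    rwa [Nat.add_sub_cancel' h1] at this)
  exact hscal _ _ _ (by simpa using pow_ne_zero k hd0) h2

lemma twistNorm_of_eigenvector (hm : 0 < m) {t : D ≃+* D} {d : D} {y : Fin m → D} (hy : y ≠ 0) {a : D}
    (h : shift m d y = leftAct t a y) : d = twistNorm t a m := by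
  have hcoord : ∀ r : Fin m, ∀ l : Fin m, ((l : ℕ) + 1) % m = r →
      d ^ (((l : ℕ) + 1) / m) * y l = (t ^ (r : ℕ)) a * y r := by
    intro r l hl
    rw [show (t ^ (r : ℕ)) a * y r = leftAct t a y r from rfl, ← h]
    change _ = (∑ l : Fin m, twistMono m d (l + 1) (y l)) r
    rw [Finset.sum_apply, Finset.sum_eq_single l]
    · simp [twistMono, hl]
    · intro i _ hi
      have : ((i : ℕ) + 1) % m ≠ r := by
        intro hir
        apply hi
        have : (i : ℕ) + 1 ≡ l + 1 [MOD m] := hir.trans hl.symm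
        exact Fin.ext ((Nat.ModEq.add_right_cancel' 1 this).eq_of_lt_of_lt i.isLt l.isLt)
      simp [twistMono, this]
    · simp
  obtain ⟨k, rfl⟩ : ∃ k, m = k + 1 := ⟨m - 1, by omega⟩
  have hstep : ∀ j (hj : j + 1 < k + 1),
      y ⟨j, by omega⟩ = (t ^ (j + 1)) a * y ⟨j + 1, hj⟩ := by
    intro j hj
    have := hcoord ⟨j + 1, hj⟩ ⟨j, by omega⟩ (Nat.mod_eq_of_lt hj)
    simpa [Nat.div_eq_of_lt hj] using this
  have hlast : d * y ⟨k, by omega⟩ = a * y ⟨0, by omega⟩ := by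
    have := hcoord ⟨0, by omega⟩ ⟨k, by omega⟩ (by simp)
    simpa using this
  have hP : ∀ j (hj : j < k + 1), twistNorm t a (j + 1) * y ⟨j, hj⟩ = d * y ⟨k, by omega⟩ := by
    intro j
    induction j with
    | zero => intro hj; simp [twistNorm, hlast]
    | succ j ih =>
      intro hj
      rw [← ih (by omega), hstep j hj, twistNorm, mul_assoc]
  have hyk : y ⟨k, by omega⟩ ≠ 0 := by
    intro h0
    have hz : ∀ i, ∀ j (hj : j < k + 1), j + i = k → y ⟨j, hj⟩ = 0 := by
      intro i
      induction i with
      | zero => rintro j hj rfl; exact h0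
      | succ i ih =>
        intro j hj hji
        rw [hstep j (by omega), ih (j + 1) (by omega) (by omega), mul_zero]
    exact hy (funext fun r => hz (k - r) r r.isLt (by omega))
  exact (mul_right_cancel₀ hyk (hP k (by omega))).symm

lemma twistNorm_of_codim_one (hm : 0 < m) {t : D ≃+* D} (ht : t ^ m = 1) {d : D}
    (hd0 : d ≠ 0) (hd : ∀ x, Commute d x) {N : Submodule D (Fin m → D)}
    (hN : ∀ v ∈ N, shiftSL hm ht hd v ∈ N) (hfin : finrank D N + 1 = m) :
    ∃ z, d = twistNorm t z m := by
  set T := shiftSL hm ht hd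
  set v := untwist t m (twistMono m d 0 1)
  have hNtop : N ≠ ⊤ := by
    rintro rfl
    simp at hfin
  have hv : v ∉ N := fun h => hNtop (eq_top_of_mono_mem hm ht hd0 hd hN one_ne_zero h)
  have hsup : N ⊔ Submodule.span D {v} = ⊤ := by
    apply Submodule.eq_top_of_finrank_eq
    have hlt : N < N ⊔ Submodule.span D {v} := by
      refine lt_of_le_of_ne le_sup_left fun h => hv ?_
      rw [h]
      exact Submodule.mem_sup_right (Submodule.mem_span_singleton_self v)
    have h1 := Submodule.finrank_lt_finrank_of_lt hlt
    have h2 := (N ⊔ Submodule.span D {v}).finrank_le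
    simp only [finrank_fin_fun] at h2 ⊢
    omega
  have hw : ∃ w : D, T v - w • v ∈ N := by
    have : T v ∈ N ⊔ Submodule.span D {v} := hsup ▸ Submodule.mem_top
    obtain ⟨p, hp, q, hq, hpq⟩ := Submodule.mem_sup.1 this
    obtain ⟨w, rfl⟩ := Submodule.mem_span_singleton.1 hq
    exact ⟨w, by rwa [← hpq, add_sub_cancel_right]⟩
  obtain ⟨w, hw⟩ := hw
  have hiter : ∀ j, T^[j] v - ((t ^ j).symm (twistNorm t (t w) j)) • v ∈ N := by
    intro j
    induction j with
    | zero => simp [twistNorm]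
    | succ j ih =>
      have h1 := hN _ ih
      have h2 := N.smul_mem (t.symm ((t ^ j).symm (twistNorm t (t w) j))) hw
      have h3 := N.add_mem h1 h2
      rw [map_sub, ← Function.iterate_succ_apply' (f := T), LinearMap.map_smulₛₗ,
        smul_sub, smul_smul] at h3
      have h4 : (t ^ (j + 1)).symm (twistNorm t (t w) (j + 1)) =
          t.symm ((t ^ j).symm (twistNorm t (t w) j)) * w := by
        rw [RingEquiv.symm_apply_eq, map_mul, twistNorm, pow_succ, RingAut.mul_apply,
          RingAut.mul_apply, RingEquiv.apply_symm_apply, RingEquiv.apply_symm_apply]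
      rw [h4]
      simpa using h3
  refine ⟨t w, ?_⟩
  have h := hiter m
  have hTm : T^[m] v = d • v := by
    rw [shiftSL_iterate_untwist, shift_iterate_twistMono hm, smul_untwist,
      leftAct_twistMono ht hd, twistMono_add_left]
    simp
  rw [hTm, ← sub_smul, ht] at h
  by_contra hne
  refine hv ((N.smul_mem_iff (sub_ne_zero.2 ?_)).1 h)
  exact hne

/-- The diagonal linear automorphism with entries the powers of a central element. -/
def powDiag (m : ℕ) {ζ : D} (hζ : ∀ x, Commute ζ x) (hζ0 : ζ ≠ 0) :
    (Fin m → D) ≃ₗ[D] (Fin m → D) where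
  toFun y := fun r => ζ ^ (r : ℕ) * y r
  invFun y := fun r => (ζ ^ (r : ℕ))⁻¹ * y r
  left_inv y := by ext r; simp [inv_mul_cancel_left₀ (pow_ne_zero _ hζ0)]
  right_inv y := by ext r; simp [mul_inv_cancel_left₀ (pow_ne_zero _ hζ0)]
  map_add' x y := by ext r; simp [mul_add]
  map_smul' a y := by
    ext r
    simp only [Pi.smul_apply, smul_eq_mul, RingHom.id_apply, ← mul_assoc,
      ((hζ a).pow_left _).eq]

lemma powDiag_untwist_twistMono {t : D ≃+* D} {d ζ : D} (hζ : ∀ x, Commute ζ x)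
    (hζ0 : ζ ≠ 0) (htζ : t ζ = ζ) (hζm : ζ ^ m = 1) (k : ℕ) (a : D) :
    powDiag m hζ hζ0 (untwist t m (twistMono m d k a)) =
      untwist t m (twistMono m d k (ζ ^ k * a)) := by
  ext r
  change ζ ^ (r : ℕ) * (t ^ (r : ℕ)).symm (twistMono m d k a r) =
    (t ^ (r : ℕ)).symm (twistMono m d k (ζ ^ k * a) r)
  by_cases h : k % m = (r : ℕ)
  · simp only [twistMono, h, if_true]
    rw [← pow_mod_of_pow_eq_one hζm k, h, ← mul_assoc (d ^ (k / m)),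
      (((hζ _).pow_left _).symm).eq, mul_assoc, RingEquiv.eq_symm_apply, map_mul,
      RingEquiv.apply_symm_apply, map_pow, ringEquiv_pow_apply_eq htζ]
  · simp [twistMono, h]

lemma shiftSL_powDiag (hm : 0 < m) {t : D ≃+* D} (ht : t ^ m = 1) {d ζ : D}
    (hd : ∀ x, Commute d x) (hζ : ∀ x, Commute ζ x)
    (hζ0 : ζ ≠ 0) (htζ : t ζ = ζ) (hζm : ζ ^ m = 1) (v : Fin m → D) :
    shiftSL hm ht hd (powDiag m hζ hζ0 v) =
      ζ⁻¹ • powDiag m hζ hζ0 (shiftSL hm ht hd v) := by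
  obtain ⟨y, rfl⟩ := (untwist t m).surjective v
  induction y using twistMono_induction d with
  | zero => simp
  | add x y hx hy => simp only [map_add, hx, hy, smul_add]
  | mono k a =>
    rw [powDiag_untwist_twistMono hζ hζ0 htζ hζm, shiftSL_untwist, shiftSL_untwist,
      shift_twistMono hm, shift_twistMono hm, powDiag_untwist_twistMono hζ hζ0 htζ hζm,
      smul_untwist, leftAct_twistMono ht hd, map_inv₀, ringEquiv_pow_apply_eq htζ, pow_succ',
      mul_assoc, inv_mul_cancel_left₀ hζ0]

lemma eq_top_of_powDiag_stable (hm : 0 < m) {t : D ≃+* D} (ht : t ^ m = 1) {d ζ : D}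
    (hd0 : d ≠ 0) (hd : ∀ x, Commute d x) (hζ : ∀ x, Commute ζ x) (hζ0 : ζ ≠ 0)
    (hprim : ∀ k, 0 < k → k < m → ζ ^ k ≠ 1)
    {N : Submodule D (Fin m → D)} (hN0 : N ≠ ⊥)
    (hN : ∀ v ∈ N, shiftSL hm ht hd v ∈ N) (hU : ∀ v ∈ N, powDiag m hζ hζ0 v ∈ N) :
    N = ⊤ := by
  classical
  have hlt : ∀ a b : Fin m, a < b → ζ ^ (b : ℕ) ≠ ζ ^ (a : ℕ) := by
    intro a b hab h
    have hab' : (a : ℕ) < b := hab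
    refine hprim (b - a) (by omega) (by omega) ?_
    apply mul_left_cancel₀ (pow_ne_zero (a : ℕ) hζ0)
    rw [← pow_add, Nat.add_sub_cancel' hab'.le, h, mul_one]
  have hinj : ∀ a b : Fin m, a ≠ b → ζ ^ (b : ℕ) ≠ ζ ^ (a : ℕ) := fun a b hab =>
    (lt_or_gt_of_ne hab).elim (hlt a b) fun h => (hlt b a h).symm
  have key : ∀ s : ℕ, ∀ v ∈ N, v ≠ 0 →
      (Finset.univ.filter fun r => v r ≠ 0).card ≤ s → N = ⊤ := by
    intro s
    induction s with
    | zero =>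
      intro v _ hv0 hs
      refine absurd (funext fun r => ?_) hv0
      by_contra hr
      have : r ∈ Finset.univ.filter fun r => v r ≠ 0 := by simpa using hr
      simp [Finset.card_eq_zero.1 (Nat.le_zero.1 hs)] at this
    | succ s ih =>
      intro v hv hv0 hs
      obtain ⟨a, ha⟩ := Function.ne_iff.1 hv0
      by_cases hb : ∃ b, b ≠ a ∧ v b ≠ 0
      · obtain ⟨b, hba, hb⟩ := hb
        have hval : ∀ r, (powDiag m hζ hζ0 v - ζ ^ (a : ℕ) • v) r =
            (ζ ^ (r : ℕ) - ζ ^ (a : ℕ)) * v r := fun r => (sub_mul _ _ _).symm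
        refine ih _ (N.sub_mem (hU v hv) (N.smul_mem (ζ ^ (a : ℕ)) hv)) ?_ ?_
        · refine Function.ne_iff.2 ⟨b, ?_⟩
          rw [hval]
          exact mul_ne_zero (sub_ne_zero.2 (hinj a b hba.symm)) hb
        · refine Nat.le_of_lt_succ (lt_of_lt_of_le (Finset.card_lt_card ?_) hs)
          refine (Finset.ssubset_iff_of_subset ?_).2 ⟨a, by simpa using ha, by simp [hval]⟩
          intro r hr
          simp only [Finset.mem_filter, Finset.mem_univ, true_and, hval] at hr ⊢
          exact right_ne_zero_of_mul hr
      · push Not at hb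
        refine eq_top_of_mono_mem hm ht hd0 hd hN (k := a) (a := (t ^ (a : ℕ)) (v a))
          ((map_ne_zero_iff _ (RingEquiv.injective _)).2 ha) ?_
        convert hv using 1
        rw [← AddEquiv.eq_symm_apply]
        ext r
        change _ = (t ^ (r : ℕ)) (v r)
        by_cases hr : r = a
        · subst hr
          simp only [twistMono, Nat.mod_eq_of_lt r.isLt, Nat.div_eq_of_lt r.isLt, if_true,
            pow_zero, one_mul]
        · have : (a : ℕ) ≠ r := fun h => hr (Fin.ext h.symm)
          simp [twistMono, Nat.mod_eq_of_lt a.isLt, this, hb r hr]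
  obtain ⟨v, hv, hv0⟩ := N.ne_bot_iff.1 hN0
  exact key _ v hv hv0 le_rfl

/-- A nontrivial zero divisor arising from a norm. -/
lemma exists_twistMul_eq_zero (hm : 1 < m) (t : D ≃+* D) {d z : D} (hd0 : d ≠ 0)
    (hz : d = twistNorm t z m) :
    ∃ x y : Fin m → D, x ≠ 0 ∧ y ≠ 0 ∧ twistMul m t d x y = 0 := by
  have hm0 : 0 < m := by omega
  have hz0 : z ≠ 0 := by
    rintro rfl
    obtain ⟨k, rfl⟩ : ∃ k, m = k + 1 := ⟨m - 1, by omega⟩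
    exact hd0 (by rw [hz, twistNorm, map_zero, mul_zero])
  have hP0 : ∀ j, twistNorm t z j ≠ 0 := by
    intro j
    induction j with
    | zero => exact one_ne_zero
    | succ j ih => exact mul_ne_zero ih ((map_ne_zero_iff _ (RingEquiv.injective _)).2 hz0)
  set f : ℕ → Fin m → D := fun l => twistMono m d l ((twistNorm t z l)⁻¹ * d) with hf
  set y : Fin m → D := fun l => (twistNorm t z (l + 1))⁻¹ * d with hy
  have hshift : twistMul m t d (twistMono m d 1 1) y = ∑ l ∈ Finset.range m, f (l + 1) := by
    unfold twistMul
    rw [sum_apply_twistMono hm0 d 1 1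
      (fun i a => ∑ l : Fin m, twistMono m d (i + (l : ℕ)) ((t ^ (l : ℕ)) a * y l)) (by simp),
      ← Fin.sum_univ_eq_sum_range (fun l => f (l + 1))]
    simp [Nat.mod_eq_of_lt hm, Nat.div_eq_of_lt hm, hf, hy, add_comm 1]
  have hact : twistMul m t d (twistMono m d 0 z) y = ∑ l ∈ Finset.range m, f l := by
    rw [twistMono_zero_twistMul _ _ _ hm0, ← Fin.sum_univ_eq_sum_range f,
      ← sum_twistMono d fun k : Fin m => (t ^ (k : ℕ)) z * y k]
    refine Finset.sum_congr rfl fun l _ => ?_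
    have h0 : (t ^ (l : ℕ)) z ≠ 0 := (map_ne_zero_iff _ (RingEquiv.injective _)).2 hz0
    simp only [hf, hy, twistNorm, mul_inv_rev, mul_assoc, mul_inv_cancel_left₀ h0]
  have hends : f m = f 0 := by
    have := twistMono_add_left (n := m) d 0 ((twistNorm t z m)⁻¹ * d)
    rw [zero_add, ← hz, inv_mul_cancel₀ hd0, mul_one] at this
    simp only [hf, ← hz, inv_mul_cancel₀ hd0, this, twistNorm, inv_one, one_mul]
  refine ⟨twistMono m d 1 1 + twistMono m d 0 (-z), y, ?_, ?_, ?_⟩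
  · refine Function.ne_iff.2 ⟨⟨1, hm⟩, ?_⟩
    simp [twistMono, Nat.mod_eq_of_lt hm, Nat.div_eq_of_lt hm]
  · exact Function.ne_iff.2 ⟨⟨0, hm0⟩, mul_ne_zero (inv_ne_zero (hP0 _)) hd0⟩
  · have hneg :
        twistMul m t d (twistMono m d 0 (-z)) y = -twistMul m t d (twistMono m d 0 z) y := by
      rw [eq_neg_iff_add_eq_zero, ← add_twistMul, ← twistMono_add, neg_add_cancel,
        twistMono_zero, zero_twistMul]
    rw [add_twistMul, hneg, hshift, hact, ← sub_eq_add_neg, ← Finset.sum_sub_distrib,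
      Finset.sum_range_sub, hends, sub_self]

theorem twistMul_division_iff (hmp : m.Prime) {t : D ≃+* D} (ht : t ^ m = 1) {d : D}
    (hd0 : d ≠ 0) (hd : ∀ x, Commute d x)
    (hroot : m ≠ 2 → m ≠ 3 → ∃ ζ : D, (∀ x, Commute ζ x) ∧ t ζ = ζ ∧ ζ ^ m = 1 ∧
      ∀ k : ℕ, 0 < k → k < m → ζ ^ k ≠ 1) :
    (∀ x y : Fin m → D, x ≠ 0 → y ≠ 0 → twistMul m t d x y ≠ 0) ↔
      ∀ z : D, d ≠ twistNorm t z m := by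
  constructor
  · intro h z hz
    obtain ⟨x, y, hx, hy, hxy⟩ := exists_twistMul_eq_zero hmp.one_lt t hd0 hz
    exact h x y hx hy hxy
  intro h x y hx hy hxy
  have hm := hmp.pos
  obtain ⟨j, hj⟩ := Function.ne_iff.1 hx
  obtain ⟨N, hN0, hN, hNm⟩ := exists_stable_submodule_of_sum_eq_zero (shiftSL hm ht hd)
    (y := untwist t m y) (by simpa using hy) (fun j => if h : j < m then x ⟨j, h⟩ else 0)
    ⟨j, j.isLt, by simpa using hj⟩ (by
      rw [← Fin.sum_univ_eq_sum_range (fun j : ℕ => (shiftSL hm ht hd)^[j]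
        ((if h : j < m then x ⟨j, h⟩ else 0) • untwist t m y))]
      simpa [hxy] using (untwist_twistMul hm ht hd x y).symm)
  have hNpos : 0 < finrank D N :=
    Nat.pos_of_ne_zero fun h => hN0 (Submodule.finrank_eq_zero.1 h)
  have hline : ¬ ∃ y ≠ 0, ∃ a : D, shiftSL hm ht hd y = a • y := by
    rintro ⟨y, hy, a, hya⟩
    obtain ⟨y, rfl⟩ := (untwist t m).surjective y
    rw [shiftSL_untwist, smul_untwist, (untwist t m).injective.eq_iff] at hya
    exact h a (twistNorm_of_eigenvector hm (by simpa using hy) hya)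
  by_cases h1 : finrank D N = 1
  · exact hline (exists_eigenvector_of_finrank_eq_one _ hN h1)
  by_cases h2 : finrank D N + 1 = m
  · obtain ⟨z, hz⟩ := twistNorm_of_codim_one hm ht hd0 hd hN h2
    exact h z hz
  obtain ⟨ζ, hζ, htζ, hζm, hprim⟩ := hroot (by omega) (by omega)
  have hζ0 : ζ ≠ 0 := by
    rintro rfl
    simp [zero_pow hm.ne'] at hζm
  exact hline (exists_eigenvector_of_twist (by simpa using hmp) _ (powDiag m hζ hζ0)
    (shiftSL_powDiag hm ht hd hζ hζ0 htζ hζm)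
    (fun W hW0 hW hU => eq_top_of_powDiag_stable hm ht hd0 hd hζ hζ0 hprim hW0 hW hU)
    ⟨N, hN0, hN, by simpa using hNm⟩)

end NormCondition

section CyclicAlgebra

variable {K : Type*} [Field K]

lemma cycMul_eq_twistMul (n : ℕ) (σ : K ≃+* K) (c : K) : cycMul n σ c = twistMul n σ c := by
  ext x y r
  simp [cycMul, twistMul, twistMono, Finset.sum_apply, mul_assoc]

lemma delta0_eq_twistMono (n : ℕ) (c d : K) : delta0 n d = twistMono n c 0 d := by
  ext r
  simp [delta0, twistMono, eq_comm]

/-- The conditions under which `(K/F, σ, c)` is an associative unital algebra of degree `n`. -/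
class IsCyclicDatum (n : ℕ) (σ : K ≃+* K) (c : K) : Prop where
  pos : 0 < n
  pow_eq_one : σ ^ n = 1
  map_eq : σ c = c

lemma exists_twistMul_eq_one {n : ℕ} {σ : K ≃+* K} {c : K} [h : IsCyclicDatum n σ c]
    (hD : ∀ x y : Fin n → K, x ≠ 0 → y ≠ 0 → twistMul n σ c x y ≠ 0)
    (x : Fin n → K) (hx : x ≠ 0) : ∃ y, twistMul n σ c x y = twistMono n c 0 1 := by
  let f : (Fin n → K) →ₗ[K] (Fin n → K) :=
    { toFun := twistMul n σ c x
      map_add' := twistMul_add σ c x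
      map_smul' := fun a y => by
        have e (z : Fin n → K) : a • z = twistMul n σ c z (twistMono n c 0 a) := by
          rw [twistMul_twistMono_zero h.pos]
          exact funext fun r => mul_comm _ _
        rw [RingHom.id_apply, e, e,
          twistMul_assoc h.pos h.pow_eq_one (Commute.all c) h.map_eq] }
  have hf : Function.Injective f := by
    rw [injective_iff_map_eq_zero]
    intro y hy
    by_contra hy0
    exact hD x y hx hy0 hy
  exact LinearMap.surjective_of_injective hf _

/-- The cyclic algebra `(K/F, σ, c)` in right coefficients. -/
def CyclicAlgebra (n : ℕ) (_σ : K ≃+* K) (_c : K) : Type _ := Fin n → K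

namespace CyclicAlgebra

variable {n : ℕ} {σ : K ≃+* K} {c : K}

instance : AddCommGroup (CyclicAlgebra n σ c) := inferInstanceAs (AddCommGroup (Fin n → K))

instance [h : IsCyclicDatum n σ c] : Ring (CyclicAlgebra n σ c) where
  __ : AddCommGroup (CyclicAlgebra n σ c) := inferInstance
  mul := twistMul n σ c
  one := twistMono n c 0 1
  left_distrib := twistMul_add σ c
  right_distrib := add_twistMul σ c
  zero_mul := zero_twistMul σ c
  mul_zero := twistMul_zero σ c
  mul_assoc := twistMul_assoc h.pos h.pow_eq_one (Commute.all c) h.map_eq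
  one_mul x := (twistMono_zero_twistMul σ 1 x h.pos).trans (by simp)
  mul_one x := (twistMul_twistMono_zero h.pos x 1).trans (by simp)

/-- The scalar `a ∈ K` as an element of the cyclic algebra. -/
def scalar (a : K) : CyclicAlgebra n σ c := twistMono n c 0 a

lemma scalar_mul [h : IsCyclicDatum n σ c] {a : K} (ha : σ a = a) (x : CyclicAlgebra n σ c) :
    scalar a * x = fun r => a * x r :=
  (twistMono_zero_twistMul σ a x h.pos).trans (by simp only [ringEquiv_pow_apply_eq ha])

lemma commute_scalar [h : IsCyclicDatum n σ c] {a : K} (ha : σ a = a)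
    (x : CyclicAlgebra n σ c) : Commute (scalar a) x :=
  (scalar_mul ha x).trans (((twistMul_twistMono_zero h.pos x a).trans
    (funext fun _ => mul_comm _ _)).symm)

lemma scalar_pow [h : IsCyclicDatum n σ c] {a : K} (ha : σ a = a) (q : ℕ) :
    (scalar a : CyclicAlgebra n σ c) ^ q = scalar (a ^ q) := by
  induction q with
  | zero => rw [pow_zero, pow_zero]; rfl
  | succ q ih =>
    rw [pow_succ', ih, pow_succ']
    refine (scalar_mul ha _).trans (funext fun r => ?_)
    simp only [scalar, twistMono, Nat.zero_mod, Nat.zero_div, pow_zero, one_mul]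
    split_ifs <;> simp

lemma scalar_injective (h : 0 < n) :
    Function.Injective (scalar : K → CyclicAlgebra n σ c) := by
  intro a b hab
  have := congrFun hab (⟨0, h⟩ : Fin n)
  simpa [scalar, twistMono] using this

/-- A cyclic algebra without zero divisors is a division ring. -/
noncomputable abbrev divisionRing [h : IsCyclicDatum n σ c]
    (hD : ∀ x y : Fin n → K, x ≠ 0 → y ≠ 0 → twistMul n σ c x y ≠ 0) :
    DivisionRing (CyclicAlgebra n σ c) :=
  have : Nontrivial (CyclicAlgebra n σ c) := (scalar_injective h.pos).nontrivial
  DivisionRing.ofIsUnitOrEqZero fun x => by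
    refine or_iff_not_imp_right.2 fun hx => ?_
    obtain ⟨y, hy⟩ : ∃ y, x * y = 1 := exists_twistMul_eq_one hD x hx
    have hy0 : y ≠ 0 := by
      rintro rfl
      rw [mul_zero] at hy
      exact zero_ne_one hy
    obtain ⟨z, hz⟩ : ∃ z, y * z = 1 := exists_twistMul_eq_one hD y hy0
    have hxz : x = z := by rw [← mul_one x, ← hz, ← mul_assoc, hy, one_mul]
    exact ⟨⟨x, y, hy, hxz ▸ hz⟩, rfl⟩

/-- The coefficientwise extension of an automorphism of `K` to the cyclic algebra. -/
def mapCoeff [h : IsCyclicDatum n σ c] (τ : K ≃+* K) (hcomm : σ * τ = τ * σ) (hτ : τ c = c) :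
    CyclicAlgebra n σ c ≃+* CyclicAlgebra n σ c where
  toFun x := fun r => τ (x r)
  invFun x := fun r => τ.symm (x r)
  left_inv x := funext fun r => τ.symm_apply_apply (x r)
  right_inv x := funext fun r => τ.apply_symm_apply (x r)
  map_add' x y := funext fun r => map_add τ (x r) (y r)
  map_mul' x y := by
    have hk (k : ℕ) (a : K) : τ ((σ ^ k) a) = (σ ^ k) (τ a) :=
      (congrArg (fun g : K ≃+* K => g a) ((show Commute σ τ from hcomm).pow_left k)).symm
    have hmono (k : ℕ) (a : K) (r : Fin n) :
        τ (twistMono n c k a r) = twistMono n c k (τ a) r := by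
      by_cases hr : k % n = (r : ℕ) <;> simp [twistMono, hr, hτ]
    refine funext fun r => ?_
    change τ (twistMul n σ c x y r) = twistMul n σ c (fun r => τ (x r)) (fun r => τ (y r)) r
    simp only [twistMul, Finset.sum_apply, map_sum, hmono, map_mul, hk]

lemma mapCoeff_pow_apply [h : IsCyclicDatum n σ c] (τ : K ≃+* K) (hcomm : σ * τ = τ * σ)
    (hτ : τ c = c) (j : ℕ) (x : CyclicAlgebra n σ c) :
    (mapCoeff (n := n) τ hcomm hτ ^ j) x = fun r => (τ ^ j) (x r) := by
  induction j with
  | zero => rfl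
  | succ j ih => rw [pow_succ', RingAut.mul_apply, ih, pow_succ']; rfl

lemma mapCoeff_scalar [h : IsCyclicDatum n σ c] {τ : K ≃+* K} (hcomm : σ * τ = τ * σ)
    (hτ : τ c = c) {a : K} (ha : τ a = a) :
    mapCoeff (n := n) τ hcomm hτ (scalar a) = scalar a := by
  refine funext fun r => ?_
  change τ (twistMono n c 0 a r) = twistMono n c 0 a r
  simp only [twistMono, Nat.zero_mod, Nat.zero_div, pow_zero, one_mul]
  split_ifs <;> simp [ha]

end CyclicAlgebra

lemma tenMul_eq_twistMul {n m : ℕ} {σ τ : K ≃+* K} {c d : K} [IsCyclicDatum n σ c]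
    (hcomm : σ * τ = τ * σ) (hτ : τ c = c) (hd : σ d = d)
    (x y : Fin m → CyclicAlgebra n σ c) :
    (fun s r => tenMul n m σ τ c d (fun i j => x j i) (fun i j => y j i) r s) =
      twistMul m (CyclicAlgebra.mapCoeff τ hcomm hτ) (CyclicAlgebra.scalar d) x y := by
  have happ (g : Fin m → CyclicAlgebra n σ c) (r : Fin n) :
      (∑ i, g i) r = ∑ i, g i r := Finset.sum_apply r _ g
  have hzero (r : Fin n) : (0 : CyclicAlgebra n σ c) r = 0 := rfl
  funext s r
  simp only [twistMul, Finset.sum_apply, happ]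
  unfold tenMul
  rw [Finset.sum_comm]
  refine Finset.sum_congr rfl fun j _ => ?_
  simp_rw [Finset.sum_comm (s := (Finset.univ : Finset (Fin n))) (t := (Finset.univ : Finset (Fin m)))]
  refine Finset.sum_congr rfl fun l _ => ?_
  rw [CyclicAlgebra.mapCoeff_pow_apply]
  by_cases hs : ((j : ℕ) + l) % m = s
  · simp only [twistMono, hs, and_true, if_true]
    rw [CyclicAlgebra.scalar_pow hd]
    have hdq : σ (d ^ (((j : ℕ) + l) / m)) = d ^ (((j : ℕ) + l) / m) := by rw [map_pow, hd]
    refine Eq.trans ?_ (congrFun (CyclicAlgebra.scalar_mul hdq _) r).symm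
    change _ = d ^ (((j : ℕ) + l) / m) *
      twistMul n σ c (fun i => (τ ^ (l : ℕ)) (x j i)) (y l) r
    rw [← cycMul_eq_twistMul]
    simp only [cycMul, Finset.mul_sum]
    refine Finset.sum_congr rfl fun i _ => Finset.sum_congr rfl fun k _ => ?_
    split_ifs
    · ring
    · simp
  · simp [twistMono, hs, hzero]

end CyclicAlgebra

/-- Suppose `d ∈ F ∖ F₀` (so `(F/F₀,τ,d)` is a nonassociative cyclic algebra
of degree `m`), `D = (K/F,σ,c)` is a division algebra, `m` is prime, and, in case `m ≠ 2, 3`,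
`F₀` contains a primitive `m`-th root of unity. Then `A = (L/F₀,σ,c) ⊗_{F₀} (F/F₀,τ,d)` is a
division algebra iff `d ≠ z·τ̃(z)·τ̃²(z)⋯τ̃^{m−1}(z)` for all `z ∈ D`. -/
theorem tensor_division_iff_norm_condition {K : Type*} [Field K] (n m : ℕ)
    (hn : 0 < n) (hmp : m.Prime)
    (σ τ : K ≃+* K) (hσord : orderOf σ = n) (hτord : orderOf τ = m)
    (hcomm : σ * τ = τ * σ)
    (hindep : ∀ i j : ℕ, i < n → j < m → σ ^ i * τ ^ j = 1 → i = 0 ∧ j = 0)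
    (hroot : m ≠ 2 → m ≠ 3 → ∃ ζ : K, σ ζ = ζ ∧ τ ζ = ζ ∧ ζ ^ m = 1 ∧
      ∀ k : ℕ, 0 < k → k < m → ζ ^ k ≠ 1)
    (c : K) (hc0 : c ≠ 0) (hcσ : σ c = c) (hcτ : τ c = c)
    (d : K) (hd0 : d ≠ 0) (hdσ : σ d = d) (hdτ : τ d ≠ d)
    (hD : ∀ x y : Fin n → K, x ≠ 0 → y ≠ 0 → cycMul n σ c x y ≠ 0) :
    (∀ x y : Fin n → Fin m → K, x ≠ 0 → y ≠ 0 → tenMul n m σ τ c d x y ≠ 0) ↔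
      ∀ z : Fin n → K, delta0 n d ≠ zProd n σ τ c z m := by
  
  have hσ : σ ^ n = 1 := hσord ▸ pow_orderOf_eq_one σ
  have hτ : τ ^ m = 1 := hτord ▸ pow_orderOf_eq_one τ
  have : IsCyclicDatum n σ c := ⟨hn, hσ, hcσ⟩
  rw [cycMul_eq_twistMul] at hD
  let _ := CyclicAlgebra.divisionRing hD
  set t : CyclicAlgebra n σ c ≃+* CyclicAlgebra n σ c := CyclicAlgebra.mapCoeff τ hcomm hcτ with ht
  have htm : t ^ m = 1 := by
    refine RingEquiv.ext fun x => ?_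
    rw [ht, CyclicAlgebra.mapCoeff_pow_apply, hτ]
    rfl
  have hinj : Function.Injective (CyclicAlgebra.scalar : K → CyclicAlgebra n σ c) :=
    CyclicAlgebra.scalar_injective hn
  have hscalar0 : (CyclicAlgebra.scalar 0 : CyclicAlgebra n σ c) = 0 := twistMono_zero c 0
  have hmain := twistMul_division_iff hmp htm (d := CyclicAlgebra.scalar d)
    (hscalar0 ▸ hinj.ne hd0) (CyclicAlgebra.commute_scalar hdσ) (fun h2 h3 => by
      obtain ⟨ζ, hσζ, hτζ, hζm, hprim⟩ := hroot h2 h3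
      refine ⟨CyclicAlgebra.scalar ζ, CyclicAlgebra.commute_scalar hσζ,
        CyclicAlgebra.mapCoeff_scalar hcomm hcτ hτζ, ?_, fun k hk hkm h => hprim k hk hkm ?_⟩
      · exact (CyclicAlgebra.scalar_pow hσζ m).trans (congrArg _ hζm)
      · exact hinj ((CyclicAlgebra.scalar_pow hσζ k).symm.trans h))
  have hnorm (z : CyclicAlgebra n σ c) (j : ℕ) : zProd n σ τ c z j = twistNorm t z j := by
    induction j with
    | zero => exact delta0_eq_twistMono n c 1
    | succ j ih =>
      change cycMul n σ c (zProd n σ τ c z j) _ = twistNorm t z j * (t ^ j) z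
      rw [ih, cycMul_eq_twistMul, ht, CyclicAlgebra.mapCoeff_pow_apply (n := n)]
      rfl
  have hten := tenMul_eq_twistMul (n := n) (m := m) hcomm hcτ hdσ
  have hswap (x : Fin n → Fin m → K) :
      x = 0 ↔ (fun j i => x i j : Fin m → CyclicAlgebra n σ c) = 0 :=
    ⟨fun h => by rw [h]; rfl, fun h => funext fun i => funext fun j =>
      congrFun (congrFun h j) i⟩
  have hleft : (∀ x y : Fin n → Fin m → K, x ≠ 0 → y ≠ 0 → tenMul n m σ τ c d x y ≠ 0) ↔
      ∀ x y : Fin m → CyclicAlgebra n σ c, x ≠ 0 → y ≠ 0 →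
        twistMul m t (CyclicAlgebra.scalar d) x y ≠ 0 := by
    constructor
    · intro h x y hx hy hxy
      exact h (fun i j => x j i) (fun i j => y j i) (fun h0 => hx ((hswap _).1 h0))
        (fun h0 => hy ((hswap _).1 h0)) ((hswap _).2 ((hten _ _).trans hxy))
    · intro h x y hx hy hxy
      exact h _ _ (fun h0 => hx ((hswap x).2 h0)) (fun h0 => hy ((hswap y).2 h0))
        ((hten (fun j i => x i j) (fun j i => y i j)).symm.trans ((hswap _).1 hxy))
  rw [hleft, hmain]
  refine forall_congr' fun z => ?_
  rw [hnorm, delta0_eq_twistMono n c d]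
  rfl
end
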